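/- For every integer n ≥ 8, the first-order forward difference of the overpartition function satisfies the Turán inequality: (Δ\bar{p}(n))^2 > (Δ\bar{p}(n-1))·(Δ\bar{p}(n+1)). -/

import Mathlib

/-- The overpartition function: `Σ_{λ ⊢ n} 2^{d(λ)}` where `d(λ)` is the number of
distinct part sizes of the partition `λ`. -/
def overpartitionFn (n : ℕ) : ℕ :=
  ∑ μ : Nat.Partition n, 2 ^ μ.parts.toFinset.card

/-- The first-order forward difference of the overpartition function, as an integer. -/
def dPbar (n : ℕ) : ℤ := (overpartitionFn (n + 1) : ℤ) - overpartitionFn n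

namespace Overpartition

open PowerSeries Filter Topology

/-- The generating series `1 + 2 X^m + 2 X^{2m} + ⋯` of overpartitions into parts equal to `m`. -/
noncomputable def partSeries (m : ℕ) : ℤ⟦X⟧ :=
  PowerSeries.mk fun n ↦ if n = 0 then 1 else if m ∣ n then 2 else 0

lemma partSeries_mul (m : ℕ) (hm : 0 < m) : partSeries m * (1 - X ^ m) = 1 + X ^ m := by
  ext n
  rw [mul_sub, mul_one, map_sub, PowerSeries.coeff_mul_X_pow', map_add, PowerSeries.coeff_one,
    PowerSeries.coeff_X_pow]
  simp only [partSeries, coeff_mk]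
  rcases Nat.eq_zero_or_pos n with h0 | h0
  · subst h0
    simp [hm.ne', hm.ne]
  rcases lt_trichotomy n m with h | h | h
  · have : ¬ m ∣ n := Nat.not_dvd_of_pos_of_lt h0 h
    simp [h0.ne', this, h.not_ge, h.ne]
  · subst h
    simp [h0.ne']
  · have h1 : m ∣ n - m ↔ m ∣ n := by
      rw [Nat.dvd_sub_self_right]
      exact or_iff_left h.not_ge
    simp [h0.ne', h.le, h.ne', h1, Nat.sub_ne_zero_of_lt h]

open WithPiTopology in
lemma coeff_prod_partSeries_eventually_eq (n : ℕ) :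
    ∀ᶠ K in atTop, (∏ i ∈ Finset.range K, partSeries (i + 1)).coeff n = overpartitionFn n := by
  let : TopologicalSpace ℤ := ⊥
  have : DiscreteTopology ℤ := ⟨rfl⟩
  have h : HasProd (fun i : ℕ ↦ partSeries (i + 1))
      (Nat.Partition.genFun (R := ℤ) fun _ _ ↦ 2) := by
    convert! Nat.Partition.hasProd_genFun (R := ℤ) (fun _ _ ↦ 2) using 2 with i
    refine eq_add_of_sub_eq' (HasSum.tsum_eq ?_).symm
    · rw [HasSum, tendsto_iff_coeff_tendsto]
      intro d
      have : HasSum (fun j : ℕ ↦ if d = (i + 1) * (j + 1) then (2 : ℤ) else 0)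
          ((partSeries (i + 1) - 1).coeff d) := by
        by_cases hd : ∃ j, d = (i + 1) * (j + 1)
        · obtain ⟨j, rfl⟩ := hd
          convert hasSum_single j _ using 1
          · simp [partSeries, coeff_one]
          · intro j' hj'
            rw [if_neg]
            intro h
            have := Nat.eq_of_mul_eq_mul_left (Nat.succ_pos i) h
            omega
        · have h0 : (partSeries (i + 1) - 1).coeff d = 0 := by
            rcases Nat.eq_zero_or_pos d with h0 | h0
            · simp [partSeries, h0]
            · have : ¬ (i + 1) ∣ d := by
                rintro ⟨c, rfl⟩
                rcases c with _ | c
                · simp at h0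
                · exact hd ⟨c, rfl⟩
              simp [partSeries, coeff_one, h0.ne', this]
          rw [h0]
          convert hasSum_zero (α := ℤ) (β := ℕ) using 2 with j
          rw [if_neg]
          exact fun h ↦ hd ⟨j, h⟩
      simpa only [HasSum, map_sum, coeff_smul, coeff_X_pow, smul_eq_mul, mul_ite, mul_one,
        mul_zero] using this
  have h2 := h.tendsto_prod_nat
  rw [tendsto_iff_coeff_tendsto] at h2
  have h3 := h2 n
  rw [Nat.Partition.coeff_genFun, nhds_discrete, tendsto_pure] at h3
  filter_upwards [h3] with K hK
  rw [hK, overpartitionFn]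
  push_cast
  refine Finset.sum_congr rfl fun p _ ↦ ?_
  simp [Finsupp.prod]

/-- The generating series of overpartitions. -/
noncomputable def overSeries : ℤ⟦X⟧ := PowerSeries.mk fun n ↦ (overpartitionFn n : ℤ)

lemma coeff_mul_eventually_eq {F G : ℕ → ℤ⟦X⟧} {f g : ℤ⟦X⟧}
    (hF : ∀ n, ∀ᶠ K in atTop, (F K).coeff n = f.coeff n)
    (hG : ∀ n, ∀ᶠ K in atTop, (G K).coeff n = g.coeff n) (n : ℕ) :
    ∀ᶠ K in atTop, (F K * G K).coeff n = (f * g).coeff n := by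
  have h1 : ∀ᶠ K in atTop, ∀ p ∈ Finset.HasAntidiagonal.antidiagonal n,
      (F K).coeff p.1 = f.coeff p.1 :=
    (Filter.eventually_all_finset _).2 fun p _ ↦ hF p.1
  have h2 : ∀ᶠ K in atTop, ∀ p ∈ Finset.HasAntidiagonal.antidiagonal n,
      (G K).coeff p.2 = g.coeff p.2 :=
    (Filter.eventually_all_finset _).2 fun p _ ↦ hG p.2
  filter_upwards [h1, h2] with K h1 h2
  rw [coeff_mul, coeff_mul]
  exact Finset.sum_congr rfl fun p hp ↦ by rw [h1 p hp, h2 p hp]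

lemma coeff_prod_euler_eventually_eq (n : ℕ) :
    ∀ᶠ K in atTop, (∏ i ∈ Finset.range K, (1 - X ^ (i + 1) : ℤ⟦X⟧)).coeff n =
      (pentagonalSeries ℤ).coeff n :=
  tendsto_finset_range.eventually (coeff_prod_one_sub_X_pow_eventually_eq ℤ n)

/-- The overpartition series times the square of Euler's series is Euler's series at `X ^ 2`. -/
theorem overSeries_mul_sq :
    overSeries * pentagonalSeries ℤ ^ 2 = expand 2 two_ne_zero (pentagonalSeries ℤ) := by
  ext n
  have hE := coeff_prod_euler_eventually_eq
  have h1 := coeff_mul_eventually_eq (f := overSeries)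
    (fun n ↦ by simpa [overSeries] using coeff_prod_partSeries_eventually_eq n)
    (coeff_mul_eventually_eq hE hE) n
  have h2 : ∀ᶠ K in atTop, (expand 2 two_ne_zero
      (∏ i ∈ Finset.range K, (1 - X ^ (i + 1) : ℤ⟦X⟧))).coeff n =
      (expand 2 two_ne_zero (pentagonalSeries ℤ)).coeff n := by
    filter_upwards [hE (n / 2)] with K hK
    by_cases h : 2 ∣ n
    · obtain ⟨k, rfl⟩ := h
      rw [coeff_expand_mul, coeff_expand_mul]
      simpa using hK
    · rw [coeff_expand_of_not_dvd _ _ _ h, coeff_expand_of_not_dvd _ _ _ h]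
  obtain ⟨K, h1, h2⟩ := (h1.and h2).exists
  rw [pow_two, ← h1, ← h2]
  congr 1
  rw [map_prod, ← Finset.prod_mul_distrib, ← Finset.prod_mul_distrib]
  refine Finset.prod_congr rfl fun i _ ↦ ?_
  rw [← mul_assoc, partSeries_mul (i + 1) (by omega)]
  simp only [map_sub, map_one, map_pow, expand_X]
  ring

end Overpartition

namespace Overpartition

open PowerSeries Filter Topology

/-- Euler's product `∏ (1 - q ^ n)`. -/
noncomputable def euler (q : ℂ) : ℂ := ∏' n : ℕ, (1 - q ^ (n + 1))

/-- The function `∏ (1 + q ^ n) / (1 - q ^ n)` as an eta quotient. -/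
noncomputable def overGen (q : ℂ) : ℂ := euler (q ^ 2) / euler q ^ 2

lemma one_sub_pow_ne_zero {q : ℂ} (hq : ‖q‖ < 1) (n : ℕ) : 1 - q ^ (n + 1) ≠ 0 := by
  intro h
  have h1 : ‖q ^ (n + 1)‖ = 1 := by rw [← sub_eq_zero.1 h, norm_one]
  rw [norm_pow] at h1
  exact (pow_lt_one₀ (norm_nonneg q) hq n.succ_ne_zero).ne h1

lemma euler_ne_zero {q : ℂ} (hq : ‖q‖ < 1) : euler q ≠ 0 := by
  have := tprod_one_add_ne_zero_of_summable (f := fun n : ℕ ↦ -q ^ (n + 1))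
    (fun n ↦ by simpa [sub_eq_add_neg] using one_sub_pow_ne_zero hq n)
    (by simpa using (summable_nat_add_iff 1).mpr (summable_geometric_of_lt_one (norm_nonneg _) hq))
  simpa [euler, sub_eq_add_neg] using this

lemma tendsto_prod_euler {q : ℂ} (hq : ‖q‖ < 1) :
    Tendsto (fun K ↦ ∏ i ∈ Finset.range K, (1 - q ^ (i + 1))) atTop (𝓝 (euler q)) :=
  (ModularForm.multipliable_one_sub_pow hq).hasProd.tendsto_prod_nat

lemma norm_sq_lt_one {q : ℂ} (hq : ‖q‖ < 1) : ‖q ^ 2‖ < 1 := by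
  rw [norm_pow]
  exact pow_lt_one₀ (norm_nonneg q) hq two_ne_zero

lemma tendsto_prod_overGen {q : ℂ} (hq : ‖q‖ < 1) :
    Tendsto (fun K ↦ ∏ i ∈ Finset.range K, ((1 + q ^ (i + 1)) / (1 - q ^ (i + 1)))) atTop
      (𝓝 (overGen q)) := by
  have h := (tendsto_prod_euler (norm_sq_lt_one hq)).div ((tendsto_prod_euler hq).pow 2)
    (pow_ne_zero 2 (euler_ne_zero hq))
  refine h.congr fun K ↦ ?_
  rw [Pi.div_apply, ← Finset.prod_pow, ← Finset.prod_div_distrib]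
  refine Finset.prod_congr rfl fun i _ ↦ ?_
  have := one_sub_pow_ne_zero hq i
  field_simp
  ring

lemma coeff_partSeries_nonneg (m n : ℕ) : 0 ≤ (partSeries m).coeff n := by
  simp only [partSeries, coeff_mk]
  split_ifs <;> norm_num

lemma coeff_prod_partSeries_nonneg (K n : ℕ) :
    0 ≤ (∏ i ∈ Finset.range K, partSeries (i + 1)).coeff n := by
  induction K generalizing n with
  | zero =>
    rw [Finset.prod_range_zero, coeff_one]
    split_ifs <;> norm_num
  | succ K ih =>
    rw [Finset.prod_range_succ, coeff_mul]
    exact Finset.sum_nonneg fun p _ ↦ mul_nonneg (ih _) (coeff_partSeries_nonneg _ _)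

lemma coeff_prod_partSeries_monotone (n : ℕ) :
    Monotone fun K ↦ (∏ i ∈ Finset.range K, partSeries (i + 1)).coeff n := by
  refine monotone_nat_of_le_succ fun K ↦ ?_
  rw [Finset.prod_range_succ, coeff_mul]
  have := Finset.single_le_sum (s := Finset.HasAntidiagonal.antidiagonal n)
    (f := fun p ↦ (∏ i ∈ Finset.range K, partSeries (i + 1)).coeff p.1 *
      (partSeries (K + 1)).coeff p.2)
    (fun p _ ↦ mul_nonneg (coeff_prod_partSeries_nonneg _ _) (coeff_partSeries_nonneg _ _))
    (a := (n, 0)) (by simp)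
  simpa [partSeries] using this

lemma coeff_prod_partSeries_le (K n : ℕ) :
    (∏ i ∈ Finset.range K, partSeries (i + 1)).coeff n ≤ overpartitionFn n := by
  obtain ⟨L, h1, h2⟩ :=
    ((coeff_prod_partSeries_eventually_eq n).and (eventually_ge_atTop K)).exists
  rw [← h1]
  exact coeff_prod_partSeries_monotone n h2

/-- The power series `F` converges absolutely at `q`, with sum `v`. -/
def EvalsTo (q : ℂ) (F : ℤ⟦X⟧) (v : ℂ) : Prop :=
  Summable (fun n ↦ ‖(F.coeff n : ℂ) * q ^ n‖) ∧ HasSum (fun n ↦ (F.coeff n : ℂ) * q ^ n) v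

lemma EvalsTo.mul {q : ℂ} {F G : ℤ⟦X⟧} {v w : ℂ} (hF : EvalsTo q F v) (hG : EvalsTo q G w) :
    EvalsTo q (F * G) (v * w) := by
  have key : ∀ n, (((F * G).coeff n : ℤ) : ℂ) * q ^ n =
      ∑ p ∈ Finset.HasAntidiagonal.antidiagonal n,
        ((F.coeff p.1 : ℂ) * q ^ p.1) * ((G.coeff p.2 : ℂ) * q ^ p.2) := by
    intro n
    rw [coeff_mul, Int.cast_sum, Finset.sum_mul]
    refine Finset.sum_congr rfl fun p hp ↦ ?_
    rw [← Finset.HasAntidiagonal.mem_antidiagonal.1 hp, pow_add]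
    push_cast
    ring
  have h1 := summable_norm_sum_mul_antidiagonal_of_summable_norm hF.1 hG.1
  have h2 := tsum_mul_tsum_eq_tsum_sum_antidiagonal_of_summable_norm hF.1 hG.1
  rw [hF.2.tsum_eq, hG.2.tsum_eq] at h2
  unfold EvalsTo
  simp_rw [key]
  exact ⟨h1, h2 ▸ h1.of_norm.hasSum⟩

lemma evalsTo_partSeries {q : ℂ} (hq : ‖q‖ < 1) (m : ℕ) :
    EvalsTo q (partSeries (m + 1)) ((1 + q ^ (m + 1)) / (1 - q ^ (m + 1))) := by
  have hs : Summable (fun n ↦ ‖((partSeries (m + 1)).coeff n : ℂ) * q ^ n‖) := by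
    refine Summable.of_nonneg_of_le (fun _ ↦ norm_nonneg _) (fun n ↦ ?_)
      ((summable_geometric_of_lt_one (norm_nonneg _) hq).mul_left 2)
    rw [norm_mul, norm_pow]
    refine mul_le_mul_of_nonneg_right ?_ (by positivity)
    simp only [partSeries, coeff_mk]
    split_ifs <;> norm_num
  have h1 : EvalsTo q (1 - X ^ (m + 1)) (1 - q ^ (m + 1)) := by
    have h : HasSum (fun n ↦ (((1 - X ^ (m + 1) : ℤ⟦X⟧).coeff n : ℤ) : ℂ) * q ^ n)
        (∑ n ∈ Finset.range (m + 2), (((1 - X ^ (m + 1) : ℤ⟦X⟧).coeff n : ℤ) : ℂ) * q ^ n) := by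
      refine hasSum_sum_of_ne_finset_zero fun n hn ↦ ?_
      have : m + 2 ≤ n := by simpa using hn
      simp [coeff_one, coeff_X_pow, show n ≠ 0 by omega, show n ≠ m + 1 by omega]
    have hval : ∑ n ∈ Finset.range (m + 2), (((1 - X ^ (m + 1) : ℤ⟦X⟧).coeff n : ℤ) : ℂ) * q ^ n
        = 1 - q ^ (m + 1) := by
      simp [coeff_one, coeff_X_pow, sub_mul, Finset.sum_sub_distrib, ite_mul]
    refine ⟨h.summable.norm, hval ▸ h⟩
  have h2 : EvalsTo q (1 + X ^ (m + 1)) (1 + q ^ (m + 1)) := by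
    have h : HasSum (fun n ↦ (((1 + X ^ (m + 1) : ℤ⟦X⟧).coeff n : ℤ) : ℂ) * q ^ n)
        (∑ n ∈ Finset.range (m + 2), (((1 + X ^ (m + 1) : ℤ⟦X⟧).coeff n : ℤ) : ℂ) * q ^ n) := by
      refine hasSum_sum_of_ne_finset_zero fun n hn ↦ ?_
      have : m + 2 ≤ n := by simpa using hn
      simp [coeff_one, coeff_X_pow, show n ≠ 0 by omega, show n ≠ m + 1 by omega]
    have hval : ∑ n ∈ Finset.range (m + 2), (((1 + X ^ (m + 1) : ℤ⟦X⟧).coeff n : ℤ) : ℂ) * q ^ n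
        = 1 + q ^ (m + 1) := by
      simp [coeff_one, coeff_X_pow, add_mul, Finset.sum_add_distrib, ite_mul]
    refine ⟨h.summable.norm, hval ▸ h⟩
  have h3 := EvalsTo.mul ⟨hs, hs.of_norm.hasSum⟩ h1
  rw [partSeries_mul _ (by omega)] at h3
  have h4 := h3.2.unique h2.2
  rw [← h4, mul_div_cancel_right₀ _ (one_sub_pow_ne_zero hq m)]
  exact ⟨hs, hs.of_norm.hasSum⟩

lemma evalsTo_prod_partSeries {q : ℂ} (hq : ‖q‖ < 1) (K : ℕ) :
    EvalsTo q (∏ i ∈ Finset.range K, partSeries (i + 1))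
      (∏ i ∈ Finset.range K, ((1 + q ^ (i + 1)) / (1 - q ^ (i + 1)))) := by
  induction K with
  | zero =>
    have h : HasSum (fun n ↦ (((1 : ℤ⟦X⟧).coeff n : ℤ) : ℂ) * q ^ n) 1 := by
      convert hasSum_single 0 _ using 1
      · simp
      · intro n hn
        simp [coeff_one, hn]
    simpa using (show EvalsTo q 1 1 from ⟨h.summable.norm, h⟩)
  | succ K ih =>
    rw [Finset.prod_range_succ, Finset.prod_range_succ]
    exact ih.mul (evalsTo_partSeries hq K)

lemma summable_overpartitionFn {r : ℝ} (h0 : 0 ≤ r) (h1 : r < 1) :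
    Summable fun n ↦ (overpartitionFn n : ℝ) * r ^ n := by
  have hq : ‖(r : ℂ)‖ < 1 := by rwa [Complex.norm_real, Real.norm_of_nonneg h0]
  have hre := (Complex.continuous_re.tendsto _).comp (tendsto_prod_overGen hq)
  refine summable_of_sum_range_le (c := (overGen r).re) (fun n ↦ by positivity) fun N ↦ ?_
  refine ge_of_tendsto hre ?_
  have hev : ∀ᶠ K in atTop, ∀ n ∈ Finset.range N,
      (∏ i ∈ Finset.range K, partSeries (i + 1)).coeff n = overpartitionFn n :=
    (Filter.eventually_all_finset _).2 fun n _ ↦ coeff_prod_partSeries_eventually_eq n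
  filter_upwards [hev] with K hK
  have hs := Complex.hasSum_re (evalsTo_prod_partSeries hq K).2
  refine le_trans (le_of_eq ?_) (sum_le_hasSum (Finset.range N) (fun n _ ↦ ?_) hs)
  · refine Finset.sum_congr rfl fun n hn ↦ ?_
    rw [hK n hn]
    norm_cast
  · have := coeff_prod_partSeries_nonneg K n
    norm_cast
    positivity

/-- The generating function of overpartitions in the unit disc. -/
theorem hasSum_overpartitionFn {q : ℂ} (hq : ‖q‖ < 1) :
    HasSum (fun n ↦ (overpartitionFn n : ℂ) * q ^ n) (overGen q) := by
  have hs := summable_overpartitionFn (norm_nonneg q) hq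
  have hs' : Summable (fun n ↦ (overpartitionFn n : ℂ) * q ^ n) := by
    refine Summable.of_norm ?_
    simpa using hs
  have hlim := tendsto_tsum_of_dominated_convergence (𝓕 := atTop)
    (f := fun K n ↦ (((∏ i ∈ Finset.range K, partSeries (i + 1)).coeff n : ℤ) : ℂ) * q ^ n)
    (g := fun n ↦ (overpartitionFn n : ℂ) * q ^ n) hs
    (fun n ↦ tendsto_nhds_of_eventually_eq <| by
      filter_upwards [coeff_prod_partSeries_eventually_eq n] with K hK
      rw [hK, Int.cast_natCast])
    (Eventually.of_forall fun K n ↦ by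
      rw [norm_mul, norm_pow, Complex.norm_intCast]
      refine mul_le_mul_of_nonneg_right ?_ (by positivity)
      rw [abs_of_nonneg (by exact_mod_cast coeff_prod_partSeries_nonneg K n)]
      exact_mod_cast coeff_prod_partSeries_le K n)
  simp_rw [(evalsTo_prod_partSeries hq _).2.tsum_eq] at hlim
  rw [← tendsto_nhds_unique hlim (tendsto_prod_overGen hq)]
  exact hs'.hasSum

end Overpartition

namespace Overpartition

open PowerSeries Filter Topology

open scoped Real in
lemma eta_I_mul (w : ℂ) :
    ModularForm.eta (Complex.I * w) =
      Complex.exp (-(π * w / 12)) * euler (Complex.exp (-(2 * π * w))) := by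
  unfold ModularForm.eta euler
  congr 1
  · simp only [Function.Periodic.qParam]
    congr 1
    push_cast
    linear_combination (π * w / 12 : ℂ) * Complex.I_sq
  · congr 1
    ext n
    rw [ModularForm.eta_q_eq_pow]
    congr 3
    linear_combination (2 * π * w : ℂ) * Complex.I_sq

lemma sqrt_I_mul {w : ℂ} (hw : 0 < w.re) :
    Complex.sqrt (Complex.I * w) = Complex.sqrt Complex.I * Complex.sqrt w := by
  have hw0 : w ≠ 0 := fun h ↦ by simp [h] at hw
  have harg := Complex.abs_arg_lt_pi_div_two_iff.2 (Or.inl hw)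
  rw [abs_lt] at harg
  unfold Complex.sqrt
  rw [Complex.cpow_def_of_ne_zero (mul_ne_zero Complex.I_ne_zero hw0),
    Complex.cpow_def_of_ne_zero Complex.I_ne_zero, Complex.cpow_def_of_ne_zero hw0,
    Complex.log_mul Complex.I_ne_zero hw0, add_mul, Complex.exp_add]
  rw [Complex.arg_I]
  constructor <;> linarith

lemma sq_sqrt (w : ℂ) : Complex.sqrt w ^ 2 = w := by
  simp [Complex.sqrt]

lemma sqrt_ne_zero {w : ℂ} (hw : w ≠ 0) : Complex.sqrt w ≠ 0 := fun h ↦ hw (by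
  rw [← sq_sqrt w, h]; simp)

lemma norm_sqrt (w : ℂ) : ‖Complex.sqrt w‖ = √‖w‖ := by
  rw [eq_comm, Real.sqrt_eq_iff_mul_self_eq (norm_nonneg _) (norm_nonneg _), ← norm_mul, ← sq,
    sq_sqrt]

lemma eta_inv {w : ℂ} (hw : 0 < w.re) :
    ModularForm.eta (Complex.I * w⁻¹) = Complex.sqrt w * ModularForm.eta (Complex.I * w) := by
  have hw0 : w ≠ 0 := fun h ↦ by simp [h] at hw
  have h := ModularForm.eta_comp_eq_csqrt_I_inv (x := Complex.I * w) (by simpa using hw)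
  simp only [Function.comp, Pi.smul_apply, Pi.mul_apply, smul_eq_mul] at h
  rw [show Complex.I * w⁻¹ = -1 / (Complex.I * w) by
    field_simp
    simp, h, sqrt_I_mul hw]
  have := sqrt_ne_zero Complex.I_ne_zero
  field_simp

open scoped Real in
lemma euler_inv {w : ℂ} (hw : 0 < w.re) :
    Complex.exp (-(π * w⁻¹ / 12)) * euler (Complex.exp (-(2 * π * w⁻¹))) =
      Complex.sqrt w * (Complex.exp (-(π * w / 12)) * euler (Complex.exp (-(2 * π * w)))) := by
  rw [← eta_I_mul, ← eta_I_mul, eta_inv hw]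

open scoped Real in
lemma norm_exp_neg_lt_one {w : ℂ} {c : ℝ} (hc : 0 < c) (hw : 0 < w.re) :
    ‖Complex.exp (-(c * w))‖ < 1 := by
  rw [Complex.norm_exp, Real.exp_lt_one_iff]
  simp only [Complex.neg_re, Complex.re_ofReal_mul]
  nlinarith [mul_pos hc hw]

open scoped Real in
/-- The modular transformation of the overpartition generating function. -/
theorem overGen_exp_neg {t : ℂ} (ht : 0 < t.re) :
    overGen (Complex.exp (-(π * t))) =
      Complex.sqrt t / 2 * Complex.exp (π * t⁻¹ / 4) *
        (euler (Complex.exp (-(2 * π * t⁻¹))) / euler (Complex.exp (-(2 * π * t⁻¹)) ^ 2) ^ 2) := by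
  have ht0 : t ≠ 0 := fun h ↦ by simp [h] at ht
  have ht2 : 0 < (t / 2).re := by simpa using ht
  have hti : 0 < (t⁻¹).re := by
    rw [Complex.inv_re]
    exact div_pos ht (Complex.normSq_pos.2 ht0)
  have h1 := euler_inv ht
  have h2 := euler_inv ht2
  have e1 : Complex.exp (-(π * t)) ^ 2 = Complex.exp (-(2 * π * t)) := by
    rw [← Complex.exp_nat_mul]; congr 1; push_cast; ring
  have e2 : Complex.exp (-(2 * π * t⁻¹)) ^ 2 = Complex.exp (-(2 * π * (t / 2)⁻¹)) := by
    rw [← Complex.exp_nat_mul]; congr 1; push_cast; field_simp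
  have e3 : Complex.exp (-(2 * π * (t / 2))) = Complex.exp (-(π * t)) := by
    congr 1; ring
  rw [e3] at h2
  unfold overGen
  rw [e1, e2]
  have hp := Real.pi_pos
  have n1 := euler_ne_zero (norm_exp_neg_lt_one hp ht)
  have n2 : euler (Complex.exp (-(2 * π * (t / 2)⁻¹))) ≠ 0 := by
    rw [← e2]
    have := norm_sq_lt_one (norm_exp_neg_lt_one (c := 2 * π) (by positivity) hti)
    push_cast at this
    exact euler_ne_zero this
  rw [div_eq_iff (pow_ne_zero 2 n1)]
  have h3 := congrArg (· ^ 2) h2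
  simp only [mul_pow, sq_sqrt] at h3
  have s1 := sqrt_ne_zero ht0
  have s2 := sq_sqrt t
  have x1 : Complex.exp (-(π * t / 12)) ≠ 0 := Complex.exp_ne_zero _
  have x2 : Complex.exp (-(π * t⁻¹ / 12)) ≠ 0 := Complex.exp_ne_zero _
  have k1 : Complex.exp (-(π * (t / 2)⁻¹ / 12)) ^ 2 * Complex.exp (π * t⁻¹ / 4) =
      Complex.exp (-(π * t⁻¹ / 12)) := by
    rw [← Complex.exp_nat_mul, ← Complex.exp_add]
    congr 1
    push_cast
    field_simp
    ring
  have k2 : Complex.exp (-(π * (t / 2) / 12)) ^ 2 = Complex.exp (-(π * t / 12)) := by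
    rw [← Complex.exp_nat_mul]
    congr 1
    push_cast
    ring
  rw [k2] at h3
  have x3 : Complex.exp (-(π * (t / 2)⁻¹ / 12)) ≠ 0 := Complex.exp_ne_zero _
  generalize Complex.exp (-(π * (t / 2)⁻¹ / 12)) = A at *
  generalize Complex.exp (-(π * t⁻¹ / 12)) = B at *
  generalize Complex.exp (-(π * t / 12)) = C at *
  generalize Complex.exp (π * t⁻¹ / 4) = D at *
  generalize euler (Complex.exp (-(2 * π * (t / 2)⁻¹))) = E at *
  generalize euler (Complex.exp (-(π * t))) = F at *
  generalize euler (Complex.exp (-(2 * π * t))) = G at *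
  generalize euler (Complex.exp (-(2 * π * t⁻¹))) = H at *
  generalize Complex.sqrt t = S at *
  field_simp
  apply mul_left_cancel₀ (mul_ne_zero s1 x1)
  linear_combination (-2 * E ^ 2) * h1 + 2 * D * H * h3 - 2 * E ^ 2 * H * k1 -
    C * D * H * F ^ 2 * s2
end Overpartition

namespace Overpartition

open PowerSeries Filter Topology

lemma log_norm_ratio_le {z : ℂ} (hz : ‖z‖ < 1) :
    Real.log ‖1 + z‖ - Real.log ‖1 - z‖ ≤
      Real.log (1 + ‖z‖) - Real.log (1 - ‖z‖) - 2 * (‖z‖ - z.re) := by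
  have key (w : ℂ) (hw : ‖w‖ < 1) :
      HasSum (fun n : ℕ ↦ ((-1) ^ (n + 1) + 1) / (n : ℝ) * (w ^ n).re)
        (Real.log ‖1 + w‖ - Real.log ‖1 - w‖) := by
    have h := Complex.hasSum_re
      ((Complex.hasSum_taylorSeries_log hw).add (Complex.hasSum_taylorSeries_neg_log hw))
    rw [← sub_eq_add_neg, Complex.sub_re, Complex.log_re, Complex.log_re] at h
    refine h.congr_fun ?_
    intro n
    have : ((-1) ^ (n + 1) * w ^ n / n + w ^ n / n : ℂ) =
      (((((-1) ^ (n + 1) + 1) / (n : ℝ) : ℝ)) : ℂ) * w ^ n := by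
      push_cast; ring
    rw [this, Complex.re_ofReal_mul]
  have h1 := key z hz
  have h2 := key (‖z‖ : ℂ) (by simpa using hz)
  have e1 : ‖1 + (‖z‖ : ℂ)‖ = 1 + ‖z‖ := by
    rw [← Complex.ofReal_one, ← Complex.ofReal_add, Complex.norm_real, Real.norm_of_nonneg]
    positivity
  have e2 : ‖1 - (‖z‖ : ℂ)‖ = 1 - ‖z‖ := by
    rw [← Complex.ofReal_one, ← Complex.ofReal_sub, Complex.norm_real, Real.norm_of_nonneg]
    linarith
  rw [e1, e2] at h2
  have h3 := h2.sub h1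
  have h4 := le_hasSum h3 1 (fun n _ ↦ by
    rw [← mul_sub]
    refine mul_nonneg (div_nonneg ?_ n.cast_nonneg) (sub_nonneg.2 ?_)
    · rcases neg_one_pow_eq_or ℝ (n + 1) with h | h <;> rw [h] <;> norm_num
    · rw [← Complex.ofReal_pow, Complex.ofReal_re, ← norm_pow]
      exact Complex.re_le_norm _)
  norm_num at h4
  linarith

lemma norm_ratio_le {z : ℂ} (hz : ‖z‖ < 1) :
    ‖(1 + z) / (1 - z)‖ ≤
      (1 + ‖z‖) / (1 - ‖z‖) * Real.exp (2 * z.re - 2 * ‖z‖) := by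
  have h0 : 0 < 1 - ‖z‖ := by linarith
  have h1 : 0 < 1 + ‖z‖ := by positivity
  have n1 : 0 < ‖1 + z‖ := norm_pos_iff.2 fun h ↦ by
    rw [← neg_eq_iff_add_eq_zero] at h
    simp [← h] at hz
  have n2 : 0 < ‖1 - z‖ := norm_pos_iff.2 fun h ↦ by
    rw [sub_eq_zero] at h
    simp [← h] at hz
  rw [norm_div, ← Real.log_le_log_iff (by positivity) (by positivity),
    Real.log_mul (by positivity) (by positivity), Real.log_exp,
    Real.log_div n1.ne' n2.ne', Real.log_div h1.ne' h0.ne']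
  linarith [log_norm_ratio_le hz]

lemma norm_overGen_le_mul_exp {q : ℂ} (hq : ‖q‖ < 1) :
    ‖overGen q‖ ≤ ‖overGen ‖q‖‖ *
      Real.exp (2 * (q / (1 - q)).re - 2 * (‖q‖ / (1 - ‖q‖))) := by
  have hq' : ‖(‖q‖ : ℂ)‖ < 1 := by simpa using hq
  have hs : HasSum (fun n : ℕ ↦ q ^ (n + 1)) (q / (1 - q)) := by
    simpa [pow_succ', div_eq_mul_inv] using (hasSum_geometric_of_norm_lt_one hq).mul_left q
  have hr : HasSum (fun n : ℕ ↦ ‖q‖ ^ (n + 1)) (‖q‖ / (1 - ‖q‖)) := by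
    simpa [pow_succ', div_eq_mul_inv] using
      (hasSum_geometric_of_lt_one (norm_nonneg q) hq).mul_left ‖q‖
  have hd := (((Complex.hasSum_re hs).mul_left 2).sub (hr.mul_left 2)).tendsto_sum_nat
  refine le_of_tendsto_of_tendsto' (tendsto_prod_overGen hq).norm
    ((tendsto_prod_overGen hq').norm.mul ((Real.continuous_exp.tendsto _).comp hd)) fun K ↦ ?_
  simp only [Function.comp]
  rw [norm_prod, norm_prod, Real.exp_sum, ← Finset.prod_mul_distrib]
  refine Finset.prod_le_prod (fun _ _ ↦ norm_nonneg _) fun i _ ↦ ?_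
  have hi : ‖q ^ (i + 1)‖ < 1 := by
    rw [norm_pow]; exact pow_lt_one₀ (norm_nonneg q) hq (by omega)
  have h := norm_ratio_le hi
  have h0 : 0 < 1 - ‖q‖ ^ (i + 1) := by rw [norm_pow] at hi; linarith
  have e : ‖(1 + (‖q‖ : ℂ) ^ (i + 1)) / (1 - (‖q‖ : ℂ) ^ (i + 1))‖ =
      (1 + ‖q‖ ^ (i + 1)) / (1 - ‖q‖ ^ (i + 1)) := by
    have : (1 + (‖q‖ : ℂ) ^ (i + 1)) / (1 - (‖q‖ : ℂ) ^ (i + 1)) =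
      (((1 + ‖q‖ ^ (i + 1)) / (1 - ‖q‖ ^ (i + 1)) : ℝ) : ℂ) := by push_cast; rfl
    rw [this, Complex.norm_real, Real.norm_of_nonneg (by positivity)]
  rw [e]
  rwa [norm_pow] at h

lemma norm_euler_sub_one_le {q : ℂ} (hq : ‖q‖ < 1) :
    ‖euler q - 1‖ ≤ Real.exp (‖q‖ / (1 - ‖q‖)) - 1 := by
  have hr : HasSum (fun n : ℕ ↦ ‖q‖ ^ (n + 1)) (‖q‖ / (1 - ‖q‖)) := by
    simpa [pow_succ', div_eq_mul_inv] using
      (hasSum_geometric_of_lt_one (norm_nonneg q) hq).mul_left ‖q‖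
  refine le_of_tendsto' ((tendsto_prod_euler hq).sub_const 1).norm fun K ↦ ?_
  have h := Finset.norm_prod_one_add_sub_one_le (Finset.range K) fun i ↦ -q ^ (i + 1)
  simp only [← sub_eq_add_neg, norm_neg, norm_pow] at h
  refine h.trans ?_
  gcongr
  exact sum_le_hasSum _ (fun _ _ ↦ by positivity) hr

lemma norm_euler_sub_one_le_two_mul {q : ℂ} (hq : ‖q‖ ≤ 1 / 500) :
    ‖euler q - 1‖ ≤ 101 / 100 * ‖q‖ := by
  have h0 := norm_nonneg q
  refine (norm_euler_sub_one_le (by linarith)).trans ?_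
  set r := ‖q‖
  have h1 : r / (1 - r) ≤ 1003 / 1000 * r := by
    rw [div_le_iff₀ (by linarith)]; nlinarith
  have h2 : 0 ≤ r / (1 - r) := div_nonneg h0 (by linarith)
  have h3 := Real.abs_exp_sub_one_sub_id_le (x := r / (1 - r)) (by rw [abs_of_nonneg h2]; linarith)
  rw [abs_le] at h3
  nlinarith [h3.2]

lemma norm_euler_ratio_sub_one_le {q : ℂ} (hq : ‖q‖ ≤ 1 / 500) :
    ‖euler q / euler (q ^ 2) ^ 2 - 1‖ ≤ 2 * ‖q‖ := by
  have h0 := norm_nonneg q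
  have h1 := norm_euler_sub_one_le_two_mul hq
  have hq2 : ‖q ^ 2‖ ≤ 1 / 500 * ‖q‖ := by rw [norm_pow]; nlinarith
  have h2 := norm_euler_sub_one_le_two_mul (q := q ^ 2) (by linarith)
  have h3 : euler (q ^ 2) ≠ 0 := euler_ne_zero (by linarith)
  set a := euler q - 1 with ha
  set b := euler (q ^ 2) - 1 with hb
  have hb1 : ‖b‖ ≤ 1 / 400 * ‖q‖ := by linarith
  have e : euler q / euler (q ^ 2) ^ 2 - 1 = (a - b * (2 + b)) / euler (q ^ 2) ^ 2 := by
    field_simp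
    rw [ha, hb]; ring
  have hn : 99 / 100 ≤ ‖euler (q ^ 2)‖ := by
    have : (1 : ℂ) = euler (q ^ 2) - b := by rw [hb]; ring
    have h5 := norm_sub_le (euler (q ^ 2)) b
    rw [← this, norm_one] at h5
    linarith
  rw [e, norm_div, norm_pow, div_le_iff₀ (by positivity)]
  have h6 : ‖a - b * (2 + b)‖ ≤ ‖a‖ + ‖b‖ * (2 + ‖b‖) := by
    refine (norm_sub_le _ _).trans ?_
    rw [norm_mul]
    gcongr
    refine (norm_add_le _ _).trans ?_
    simp
  have h7 : 9 / 10 ≤ ‖euler (q ^ 2)‖ ^ 2 := by nlinarith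
  have h8 : ‖b‖ * (2 + ‖b‖) ≤ 1 / 400 * ‖q‖ * 3 := by
    gcongr
    linarith
  nlinarith

open scoped Real in
/-- Near the singularity at `q = 1` the generating function is its leading modular term up to a
small error. -/
theorem norm_overGen_sub_le {t : ℂ} (ht : 1 ≤ (t⁻¹).re) :
    ‖overGen (Complex.exp (-(π * t))) - Complex.sqrt t / 2 * Complex.exp (π * t⁻¹ / 4)‖ ≤
      √‖t‖ := by
  have hti : 0 < (t⁻¹).re := by linarith
  have ht0 : t⁻¹ ≠ 0 := fun h ↦ by simp [h] at hti
  have htr : 0 < t.re := by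
    have : 0 < (t⁻¹⁻¹).re := by
      rw [Complex.inv_re (t⁻¹)]
      exact div_pos hti (Complex.normSq_pos.2 ht0)
    rwa [inv_inv] at this
  rw [overGen_exp_neg htr]
  set x := (t⁻¹).re
  set Q := Complex.exp (-(2 * π * t⁻¹)) with hQ
  have hp := Real.pi_gt_three
  have hQn : ‖Q‖ = Real.exp (-(2 * π * x)) := by
    rw [hQ, Complex.norm_exp]
    congr 1
    have : (-(2 * π * t⁻¹) : ℂ) = ((-(2 * π) : ℝ) : ℂ) * t⁻¹ := by push_cast; ring
    rw [this, Complex.re_ofReal_mul]; ring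
  have hE : ‖Complex.exp (π * t⁻¹ / 4)‖ = Real.exp (π * x / 4) := by
    rw [Complex.norm_exp]
    congr 1
    have : (π * t⁻¹ / 4 : ℂ) = ((π / 4 : ℝ) : ℂ) * t⁻¹ := by push_cast; ring
    rw [this, Complex.re_ofReal_mul]; ring
  have big : (500 : ℝ) ≤ Real.exp 6.28 := by
    have h1 : (2.7 : ℝ) ≤ Real.exp 1 := by linarith [Real.exp_one_gt_d9]
    have h2 : Real.exp 6.28 = Real.exp 1 ^ 6 * Real.exp 0.28 := by
      rw [← Real.exp_nat_mul, ← Real.exp_add]; norm_num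
    have h3 : (1.28 : ℝ) ≤ Real.exp 0.28 := by
      linarith [Real.add_one_le_exp (0.28 : ℝ)]
    have h4 : (2.718 : ℝ) ^ 6 ≤ Real.exp 1 ^ 6 :=
      pow_le_pow_left₀ (by norm_num) (by linarith [Real.exp_one_gt_d9]) 6
    rw [h2]
    norm_num at h4 ⊢
    nlinarith
  have hp' := Real.pi_gt_d2
  have hQs : ‖Q‖ ≤ 1 / 500 := by
    rw [hQn, Real.exp_neg, inv_eq_one_div]
    refine one_div_le_one_div_of_le (by norm_num) (big.trans (Real.exp_le_exp.2 ?_))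
    nlinarith
  have hmain := norm_euler_ratio_sub_one_le hQs
  have e : Complex.sqrt t / 2 * Complex.exp (π * t⁻¹ / 4) * (euler Q / euler (Q ^ 2) ^ 2) -
      Complex.sqrt t / 2 * Complex.exp (π * t⁻¹ / 4) =
      Complex.sqrt t / 2 * Complex.exp (π * t⁻¹ / 4) * (euler Q / euler (Q ^ 2) ^ 2 - 1) := by
    ring
  rw [e, norm_mul, norm_mul, norm_div, norm_sqrt, hE]
  calc √‖t‖ / ‖(2 : ℂ)‖ * Real.exp (π * x / 4) * ‖euler Q / euler (Q ^ 2) ^ 2 - 1‖ 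
      ≤ √‖t‖ / ‖(2 : ℂ)‖ * Real.exp (π * x / 4) * (2 * ‖Q‖) := by gcongr
    _ = √‖t‖ * (Real.exp (π * x / 4) * Real.exp (-(2 * π * x))) := by
        rw [hQn]; simp; ring
    _ ≤ √‖t‖ * 1 := by
        gcongr
        rw [← Real.exp_add, Real.exp_le_one_iff]
        nlinarith
    _ = √‖t‖ := mul_one _

open scoped Real in
lemma norm_overGen_le {t : ℝ} (h0 : 0 < t) (h1 : t ≤ 1) :
    ‖overGen (Real.exp (-(π * t)) : ℝ)‖ ≤ Real.exp (π / (4 * t)) := by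
  have hti : 1 ≤ (((t : ℂ))⁻¹).re := by
    rw [← Complex.ofReal_inv, Complex.ofReal_re]
    exact (one_le_inv₀ h0).2 h1
  have h := norm_overGen_sub_le hti
  have hn : ‖Complex.sqrt (t : ℂ) / 2 * Complex.exp (π * (t : ℂ)⁻¹ / 4)‖ =
      √t / 2 * Real.exp (π / (4 * t)) := by
    rw [norm_mul, norm_div, norm_sqrt, Complex.norm_real, Real.norm_of_nonneg h0.le]
    congr 1
    · simp
    · rw [Complex.norm_exp]
      congr 1
      have : (π * (t : ℂ)⁻¹ / 4 : ℂ) = ((π / (4 * t) : ℝ) : ℂ) := by push_cast; field_simp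
      rw [this, Complex.ofReal_re]
  rw [Complex.norm_real, Real.norm_of_nonneg h0.le] at h
  have hs : √t ≤ 1 := Real.sqrt_le_one.2 h1
  have hs0 := Real.sqrt_nonneg t
  have hx : 0.785 ≤ π / (4 * t) := by
    rw [le_div_iff₀ (by positivity)]
    linarith [Real.pi_gt_d2]
  have hexp : 2 ≤ Real.exp (π / (4 * t)) := by
    have := Real.quadratic_le_exp_of_nonneg (x := π / (4 * t)) (by linarith)
    nlinarith
  have h2 := norm_sub_norm_le (overGen (Complex.exp (-(π * (t : ℂ)))))
    (Complex.sqrt (t : ℂ) / 2 * Complex.exp (π * (t : ℂ)⁻¹ / 4))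
  rw [hn] at h2
  have e : ((Real.exp (-(π * t)) : ℝ) : ℂ) = Complex.exp (-(π * (t : ℂ))) := by push_cast; rfl
  rw [e]
  have h3 : √t * (1 + Real.exp (π / (4 * t)) / 2) ≤ 1 * (1 + Real.exp (π / (4 * t)) / 2) := by
    gcongr
  linarith
end Overpartition

namespace Overpartition

open Filter Topology
open scoped Real

/-- The integrand of Cauchy's formula for the coefficients of the generating function, on the
vertical line with abscissa `a`. -/
noncomputable def cauchyIntegrand (n : ℕ) (a y : ℝ) : ℂ :=
  overGen (Complex.exp (-(π * (a + y * Complex.I)))) * Complex.exp (π * n * (a + y * Complex.I))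

lemma norm_exp_neg_pi_mul (a y : ℝ) :
    ‖Complex.exp (-(π * (a + y * Complex.I)))‖ = Real.exp (-(π * a)) := by
  rw [Complex.norm_exp]
  simp

lemma norm_exp_pi_mul (n : ℕ) (a y : ℝ) :
    ‖Complex.exp (π * n * (a + y * Complex.I))‖ = Real.exp (π * n * a) := by
  rw [Complex.norm_exp]
  simp

lemma exp_neg_pi_mul_lt_one {a : ℝ} (ha : 0 < a) : Real.exp (-(π * a)) < 1 := by
  rw [Real.exp_lt_one_iff]
  have := mul_pos Real.pi_pos ha
  linarith

lemma hasSum_cauchyIntegrand (n : ℕ) {a : ℝ} (ha : 0 < a) (y : ℝ) :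
    HasSum (fun m ↦ (overpartitionFn m : ℂ) *
      Complex.exp (-(π * (a + y * Complex.I))) ^ m * Complex.exp (π * n * (a + y * Complex.I)))
      (cauchyIntegrand n a y) := by
  refine (hasSum_overpartitionFn ?_).mul_right _
  rw [norm_exp_neg_pi_mul]
  exact exp_neg_pi_mul_lt_one ha

lemma norm_cauchyIntegrand_term (n m : ℕ) (a y : ℝ) :
    ‖(overpartitionFn m : ℂ) *
      Complex.exp (-(π * (a + y * Complex.I))) ^ m * Complex.exp (π * n * (a + y * Complex.I))‖ =
      overpartitionFn m * Real.exp (-(π * a)) ^ m * Real.exp (π * n * a) := by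
  rw [norm_mul, norm_mul, norm_pow, norm_exp_neg_pi_mul, norm_exp_pi_mul]
  simp

lemma summable_cauchyIntegrand_bound (n : ℕ) {a : ℝ} (ha : 0 < a) :
    Summable fun m ↦ overpartitionFn m * Real.exp (-(π * a)) ^ m * Real.exp (π * n * a) :=
  (summable_overpartitionFn (Real.exp_pos _).le (exp_neg_pi_mul_lt_one ha)).mul_right _

lemma continuous_cauchyIntegrand (n : ℕ) {a : ℝ} (ha : 0 < a) :
    Continuous (cauchyIntegrand n a) := by
  have : cauchyIntegrand n a = fun y : ℝ ↦ ∑' m, (overpartitionFn m : ℂ) *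
      Complex.exp (-(π * (a + y * Complex.I))) ^ m *
        Complex.exp (π * n * (a + y * Complex.I)) := by
    ext y
    exact (hasSum_cauchyIntegrand n ha y).tsum_eq.symm
  rw [this]
  refine continuous_tsum (fun m ↦ by fun_prop) (summable_cauchyIntegrand_bound n ha) fun m y ↦ ?_
  rw [norm_cauchyIntegrand_term]

lemma integral_exp_int_mul_pi (k : ℤ) :
    ∫ y in (-1 : ℝ)..1, Complex.exp (k * π * Complex.I * y) = if k = 0 then 2 else 0 := by
  split_ifs with h
  · simp only [h, Int.cast_zero, zero_mul, Complex.exp_zero, intervalIntegral.integral_const]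
    norm_num
  · rw [integral_exp_mul_complex (by simp [h, Real.pi_ne_zero])]
    have : Complex.exp (k * π * Complex.I * (1 : ℝ)) =
        Complex.exp (k * π * Complex.I * (-1 : ℝ)) := by
      rw [Complex.exp_eq_exp_iff_exists_int]
      exact ⟨k, by push_cast; ring⟩
    rw [this, sub_self, zero_div]

theorem overpartitionFn_eq_integral (n : ℕ) {a : ℝ} (ha : 0 < a) :
    (overpartitionFn n : ℂ) = 1 / 2 * ∫ y in (-1 : ℝ)..1, cauchyIntegrand n a y := by
  have h := intervalIntegral.hasSum_integral_of_dominated_convergence (μ := MeasureTheory.volume)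
    (a := -1) (b := 1) (f := cauchyIntegrand n a)
    (F := fun m y ↦ (overpartitionFn m : ℂ) *
      Complex.exp (-(π * (a + y * Complex.I))) ^ m * Complex.exp (π * n * (a + y * Complex.I)))
    (fun m _ ↦ overpartitionFn m * Real.exp (-(π * a)) ^ m * Real.exp (π * n * a))
    (fun m ↦ by fun_prop)
    (fun m ↦ Eventually.of_forall fun y _ ↦ (norm_cauchyIntegrand_term n m a y).le)
    (Eventually.of_forall fun y _ ↦ summable_cauchyIntegrand_bound n ha)
    intervalIntegrable_const
    (Eventually.of_forall fun y _ ↦ hasSum_cauchyIntegrand n ha y)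
  have e (m : ℕ) : ∫ y in (-1 : ℝ)..1, (overpartitionFn m : ℂ) *
      Complex.exp (-(π * (a + y * Complex.I))) ^ m * Complex.exp (π * n * (a + y * Complex.I)) =
      if m = n then 2 * (overpartitionFn n : ℂ) else 0 := by
    have e1 (y : ℝ) : (overpartitionFn m : ℂ) *
      Complex.exp (-(π * (a + y * Complex.I))) ^ m * Complex.exp (π * n * (a + y * Complex.I)) =
      (overpartitionFn m : ℂ) * Complex.exp (π * a * (n - m)) *
        Complex.exp (((n : ℤ) - m : ℤ) * π * Complex.I * y) := by
      rw [← Complex.exp_nat_mul, mul_assoc (overpartitionFn m : ℂ),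
        mul_assoc (overpartitionFn m : ℂ), ← Complex.exp_add, ← Complex.exp_add]
      congr 2
      push_cast
      ring
    simp only [e1]
    rw [intervalIntegral.integral_const_mul, integral_exp_int_mul_pi]
    by_cases hm : m = n
    · subst hm; simp; ring
    · rw [if_neg hm, if_neg (by omega), mul_zero]
  simp only [e] at h
  rw [h.unique (hasSum_ite_eq n _)]
  ring

lemma norm_integral_sub_le {f g : ℝ → ℂ} (hf : Continuous f) {c B C : ℝ} (h0 : 0 ≤ c)
    (h1 : c ≤ 1) (hg : IntervalIntegrable g MeasureTheory.volume (-c) c)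
    (hB : ∀ y, |y| ≤ c → ‖f y - g y‖ ≤ B) (hC : ∀ y, c ≤ |y| → |y| ≤ 1 → ‖f y‖ ≤ C) (hB0 : 0 ≤ B)
    (hC0 : 0 ≤ C) :
    ‖(∫ y in (-1 : ℝ)..1, f y) - ∫ y in -c..c, g y‖ ≤ 2 * B + 2 * C := by
  have hi (a b : ℝ) : IntervalIntegrable f MeasureTheory.volume a b := hf.intervalIntegrable a b
  have e : (∫ y in (-1 : ℝ)..1, f y) - ∫ y in -c..c, g y =
      (∫ y in (-1 : ℝ)..-c, f y) + (∫ y in -c..c, (f y - g y)) + ∫ y in c..1, f y := by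
    rw [intervalIntegral.integral_sub (hi _ _) hg,
      ← intervalIntegral.integral_add_adjacent_intervals (hi (-1) (-c)) (hi (-c) 1),
      ← intervalIntegral.integral_add_adjacent_intervals (hi (-c) c) (hi c 1)]
    ring
  have b1 : ‖∫ y in (-1 : ℝ)..-c, f y‖ ≤ C * |(-c) - (-1)| := by
    refine intervalIntegral.norm_integral_le_of_norm_le_const fun y hy ↦ ?_
    rw [Set.uIoc_of_le (by linarith)] at hy
    have : |y| = -y := abs_of_nonpos (by linarith [hy.2])
    exact hC y (by linarith [hy.2]) (by linarith [hy.1])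
  have b2 : ‖∫ y in c..1, f y‖ ≤ C * |1 - c| := by
    refine intervalIntegral.norm_integral_le_of_norm_le_const fun y hy ↦ ?_
    rw [Set.uIoc_of_le (by linarith)] at hy
    have : |y| = y := abs_of_nonneg (by linarith [hy.1])
    exact hC y (by linarith [hy.1]) (by linarith [hy.2])
  have b3 : ‖∫ y in -c..c, (f y - g y)‖ ≤ B * |c - (-c)| := by
    refine intervalIntegral.norm_integral_le_of_norm_le_const fun y hy ↦ ?_
    rw [Set.uIoc_of_le (by linarith)] at hy
    exact hB y (abs_le.2 ⟨hy.1.le, hy.2⟩)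
  rw [abs_of_nonneg (by linarith)] at b1 b2 b3
  rw [e]
  refine (norm_add₃_le).trans ?_
  nlinarith
end Overpartition

namespace Overpartition

open Filter Topology
open scoped Real

/-- The leading term of the integrand on the major arc. -/
noncomputable def mainIntegrand (n : ℕ) (t : ℂ) : ℂ :=
  Complex.sqrt t * (Complex.exp (π * t⁻¹ / 4) * Complex.exp (π * n * t))

lemma re_vertical_inv (a y : ℝ) :
    ((a + y * Complex.I : ℂ)⁻¹).re = a / (a ^ 2 + y ^ 2) := by
  rw [Complex.inv_re, Complex.normSq_apply]
  simp
  ring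

lemma norm_cauchyIntegrand_sub_le {n : ℕ} {a y : ℝ} (h : a ^ 2 + y ^ 2 ≤ a) (h0 : 0 < a) :
    ‖cauchyIntegrand n a y - mainIntegrand n (a + y * Complex.I) / 2‖ ≤ Real.exp (π * n * a) := by
  have hp : 0 < a ^ 2 + y ^ 2 := by positivity
  have ht : 1 ≤ ((a + y * Complex.I : ℂ)⁻¹).re := by
    rw [re_vertical_inv, one_le_div hp]
    exact h
  have hn : ‖(a + y * Complex.I : ℂ)‖ ≤ 1 := by
    have := Complex.sq_norm (a + y * Complex.I)
    rw [Complex.normSq_add_mul_I] at this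
    have ha : a ≤ 1 := by nlinarith [sq_nonneg y]
    nlinarith [norm_nonneg (a + y * Complex.I : ℂ)]
  have h1 := (norm_overGen_sub_le ht).trans (Real.sqrt_le_one.2 hn)
  have e : cauchyIntegrand n a y - mainIntegrand n (a + y * Complex.I) / 2 =
      (overGen (Complex.exp (-(π * (a + y * Complex.I)))) -
        Complex.sqrt (a + y * Complex.I) / 2 *
          Complex.exp (π * (a + y * Complex.I : ℂ)⁻¹ / 4)) *
        Complex.exp (π * n * (a + y * Complex.I)) := by
    unfold cauchyIntegrand mainIntegrand
    ring
  rw [e, norm_mul, norm_exp_pi_mul]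
  exact mul_le_of_le_one_left (Real.exp_pos _).le h1

lemma normSq_one_sub_exp (a y : ℝ) :
    ‖1 - Complex.exp (-(π * (a + y * Complex.I)))‖ ^ 2 =
      (1 - Real.exp (-(π * a))) ^ 2 + 4 * Real.exp (-(π * a)) * Real.sin (π * y / 2) ^ 2 := by
  rw [Complex.sq_norm, Complex.normSq_apply]
  have hc : Real.cos (π * y) = 1 - 2 * Real.sin (π * y / 2) ^ 2 := by
    rw [← Real.cos_sq_add_sin_sq (π * y / 2)] 
    have := Real.cos_two_mul (π * y / 2)
    rw [show 2 * (π * y / 2) = π * y by ring] at this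
    nlinarith [Real.cos_sq_add_sin_sq (π * y / 2)]
  have hs := Real.cos_sq_add_sin_sq (π * y)
  simp only [Complex.sub_re, Complex.sub_im, Complex.exp_re, Complex.exp_im]
  simp
  linear_combination (Real.exp (-(π * a)))^2 * hs - 2 * Real.exp (-(π * a)) * hc

/-- Distance to `1` off the major arc. -/
lemma le_norm_one_sub_exp {a y : ℝ} (h0 : 0 < a) (h1 : a ≤ 1 / 400) (hy : √3 * a ≤ |y|)
    (hy1 : |y| ≤ 1) :
    1.97 * (1 - Real.exp (-(π * a))) ≤ ‖1 - Complex.exp (-(π * (a + y * Complex.I)))‖ := by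
  have hp := Real.pi_pos
  have hpl := Real.pi_lt_d2
  have hr1 := exp_neg_pi_mul_lt_one h0
  have hr : 1 - π * a ≤ Real.exp (-(π * a)) := by linarith [Real.add_one_le_exp (-(π * a))]
  have hs3 : √3 ^ 2 = 3 := Real.sq_sqrt (by norm_num)
  have hs3' : √3 ≤ 1.74 := Real.sqrt_le_iff.2 ⟨by norm_num, by norm_num⟩
  have hs30 : 0 < √3 := by positivity
  set b := π * a with hb
  have hb0 : 0 < b := by positivity
  have hb1 : b ≤ 0.01 := by nlinarith
  set r := Real.exp (-b)
  have hsin : √3 * b / 2 * 0.99 ≤ Real.sin (π * |y| / 2) := by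
    have m : Real.sin (√3 * b / 2) ≤ Real.sin (π * |y| / 2) := by
      apply Real.sin_le_sin_of_le_of_le_pi_div_two
      · have : 0 < √3 * b / 2 := by positivity
        linarith
      · nlinarith
      · rw [hb]; nlinarith
    have hx0 : 0 < √3 * b / 2 := by positivity
    have hx1 : √3 * b / 2 ≤ 0.01 := by nlinarith
    have := Real.sin_gt_sub_cube hx0
    nlinarith [mul_pos hx0 hx0]
  have hsq : Real.sin (π * y / 2) ^ 2 = Real.sin (π * |y| / 2) ^ 2 := by
    rcases abs_choice y with h | h <;> rw [h]
    rw [show π * -y / 2 = -(π * y / 2) by ring, Real.sin_neg, neg_sq]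
  have hx0 : 0 < √3 * b / 2 * 0.99 := by positivity
  have hsin2 : (√3 * b / 2 * 0.99) ^ 2 ≤ Real.sin (π * y / 2) ^ 2 := by
    rw [hsq]
    gcongr
  have e1 : (√3 * b / 2 * 0.99) ^ 2 = 3 / 4 * 0.99 ^ 2 * b ^ 2 := by
    linear_combination b ^ 2 / 4 * 0.99 ^ 2 * hs3
  rw [e1] at hsin2
  apply le_of_sq_le_sq _ (norm_nonneg _)
  rw [normSq_one_sub_exp]
  have : 0.99 * (3 / 4 * 0.99 ^ 2 * b ^ 2) ≤ r * Real.sin (π * y / 2) ^ 2 := by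
    gcongr
    linarith
  have h5 : (1 - r) ^ 2 ≤ b ^ 2 := by
    apply pow_le_pow_left₀ <;> linarith
  nlinarith

lemma norm_cauchyIntegrand_le {n : ℕ} {s y : ℝ} (hs : 100 ≤ s) (hn : s ^ 2 = n)
    (hy : √3 * (1 / (4 * s)) ≤ |y|) (hy1 : |y| ≤ 1) :
    ‖cauchyIntegrand n (1 / (4 * s)) y‖ ≤ Real.exp (π * s - 0.45 * s) := by
  set a := 1 / (4 * s) with ha
  have h0 : 0 < a := by positivity
  have h1 : a ≤ 1 / 400 := by
    rw [ha]
    exact one_div_le_one_div_of_le (by norm_num) (by linarith)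
  have hd := le_norm_one_sub_exp h0 h1 hy hy1
  have hr1 := exp_neg_pi_mul_lt_one h0
  have hr : 1 - π * a ≤ Real.exp (-(π * a)) := by linarith [Real.add_one_le_exp (-(π * a))]
  have hqn := norm_exp_neg_pi_mul a y
  have hG := norm_overGen_le_mul_exp (q := Complex.exp (-(π * (a + y * Complex.I))))
    (by rw [hqn]; exact hr1)
  unfold cauchyIntegrand
  rw [norm_mul, norm_exp_pi_mul]
  rw [hqn] at hG
  have hO := norm_overGen_le h0 (by linarith)
  set q := Complex.exp (-(π * (a + y * Complex.I)))
  set r := Real.exp (-(π * a))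
  have hr0 : 0 < r := Real.exp_pos _
  have hre : (q / (1 - q)).re ≤ r / (1 - r) * (1 / 1.97) := by
    refine (Complex.re_le_norm _).trans ?_
    rw [norm_div, hqn]
    refine (div_le_div_of_nonneg_left hr0.le (by linarith) hd).trans (le_of_eq ?_)
    field_simp
  have hfr : 4 * s / 3.15 - 1 ≤ r / (1 - r) := by
    have : r / (1 - r) = 1 / (1 - r) - 1 := by
      have : 1 - r ≠ 0 := by linarith
      field_simp
      ring
    rw [this]
    have h6 : 1 - r ≤ 3.15 / (4 * s) := by
      have : π * a ≤ 3.15 / (4 * s) := by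
        rw [ha, mul_one_div]
        gcongr
        exact Real.pi_lt_d2.le
      linarith
    have h7 := one_div_le_one_div_of_le (by linarith) h6
    rw [one_div_div] at h7
    linarith
  calc ‖overGen q‖ * Real.exp (π * n * a)
      ≤ (Real.exp (π / (4 * a)) * Real.exp (2 * (q / (1 - q)).re - 2 * (r / (1 - r)))) *
          Real.exp (π * n * a) := by
        gcongr
        exact hG.trans (by gcongr)
    _ = Real.exp (π / (4 * a) + (2 * (q / (1 - q)).re - 2 * (r / (1 - r))) + π * n * a) := by
        rw [Real.exp_add, Real.exp_add]
    _ ≤ _ := by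
        apply Real.exp_le_exp.2
        have e1 : π / (4 * a) = π * s := by rw [ha]; field_simp
        have e2 : π * n * a = π * s / 4 := by rw [ha, ← hn]; field_simp
        rw [e1, e2]
        have := Real.pi_lt_d2
        norm_num at *
        nlinarith
end Overpartition

namespace Overpartition

open Filter Topology
open scoped Real

lemma sqrt_sq {w : ℂ} (hw : 0 < w.re) : Complex.sqrt (w ^ 2) = w := by
  have harg := Complex.abs_arg_lt_pi_div_two_iff.2 (Or.inl hw)
  rw [abs_lt] at harg
  have := Complex.pow_cpow_nat_inv (x := w) (n := 2) two_ne_zero (by push_cast; linarith)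
    (by push_cast; linarith)
  simpa [Complex.sqrt] using this

/-- The unit circle, parametrized by its imaginary part. -/
noncomputable def unitArc (v : ℝ) : ℂ := (√(1 - v ^ 2) : ℝ) + v * Complex.I

lemma unitArc_re (v : ℝ) : (unitArc v).re = √(1 - v ^ 2) := by simp [unitArc]

lemma sqrt_one_sub_sq_pos {v : ℝ} (hv : |v| ≤ 1 / 2) : 0 < √(1 - v ^ 2) := by
  apply Real.sqrt_pos.2
  nlinarith [sq_abs v, abs_nonneg v]

lemma ofReal_sqrt_sq {v : ℝ} (hv : |v| ≤ 1 / 2) : ((√(1 - v ^ 2) : ℝ) : ℂ) ^ 2 = 1 - v ^ 2 := by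
  rw [← Complex.ofReal_pow, Real.sq_sqrt]
  · push_cast; rfl
  · nlinarith [sq_abs v, abs_nonneg v]

lemma unitArc_sq_add_inv {v : ℝ} (hv : |v| ≤ 1 / 2) :
    (unitArc v ^ 2)⁻¹ + unitArc v ^ 2 = 2 * (1 - 2 * v ^ 2) := by
  have h := ofReal_sqrt_sq hv
  have hinv : (unitArc v)⁻¹ = (√(1 - v ^ 2) : ℝ) - v * Complex.I := by
    apply inv_eq_of_mul_eq_one_right
    unfold unitArc
    linear_combination h - v ^ 2 * Complex.I_sq
  rw [← inv_pow, hinv]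
  unfold unitArc
  linear_combination 2 * h + 2 * v ^ 2 * Complex.I_sq

lemma hasDerivAt_unitArc_sq {v : ℝ} (hv : |v| ≤ 1 / 2) :
    HasDerivAt (fun v ↦ unitArc v ^ 2)
      (2 * Complex.I * unitArc v ^ 2 / (√(1 - v ^ 2) : ℝ)) v := by
  have hpos := sqrt_one_sub_sq_pos hv
  have h1 : HasDerivAt (fun v : ℝ ↦ √(1 - v ^ 2)) (-v / √(1 - v ^ 2)) v := by
    have h := ((hasDerivAt_pow 2 v).const_sub 1).sqrt (Real.sqrt_pos.1 hpos).ne'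
    refine h.congr_deriv ?_
    field_simp
    norm_num
  have h2 : HasDerivAt unitArc (((-v / √(1 - v ^ 2) : ℝ) : ℂ) + 1 * Complex.I) v :=
    h1.ofReal_comp.add ((hasDerivAt_id v).ofReal_comp.mul_const _)
  refine (h2.pow 2).congr_deriv ?_
  have : ((√(1 - v ^ 2) : ℝ) : ℂ) ≠ 0 := by exact_mod_cast hpos.ne'
  push_cast
  field_simp
  unfold unitArc
  linear_combination (-v) * (((√(1 - v ^ 2) : ℝ) : ℂ) + v * Complex.I) * Complex.I_sq

lemma re_unitArc_cube {v : ℝ} (hv : |v| ≤ 1 / 2) :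
    (unitArc v ^ 3 / (√(1 - v ^ 2) : ℝ)).re = 1 - 4 * v ^ 2 := by
  have hpos := sqrt_one_sub_sq_pos hv
  have h : √(1 - v ^ 2) ^ 2 = 1 - v ^ 2 := Real.sq_sqrt (Real.sqrt_pos.1 hpos).le
  rw [Complex.div_ofReal_re]
  have e : (unitArc v ^ 3).re = √(1 - v ^ 2) ^ 3 - 3 * √(1 - v ^ 2) * v ^ 2 := by
    unfold unitArc
    simp [pow_succ]
    ring
  rw [e]
  field_simp
  linear_combination h

lemma differentiableAt_mainIntegrand (n : ℕ) {t : ℂ} (ht : 0 < t.re) :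
    DifferentiableAt ℂ (mainIntegrand n) t := by
  have h0 : t ≠ 0 := fun h ↦ by simp [h] at ht
  have := Complex.differentiableAt_sqrt (z := t) (Or.inl ht)
  unfold mainIntegrand
  fun_prop (disch := assumption)

lemma mainIntegrand_arc {n : ℕ} {s v : ℝ} (hs : 0 < s) (hn : s ^ 2 = n) (hv : |v| ≤ 1 / 2) :
    mainIntegrand n ((1 / (2 * s) : ℝ) * unitArc v ^ 2) =
      (√(1 / (2 * s)) : ℝ) * unitArc v * (Real.exp (π * s * (1 - 2 * v ^ 2)) : ℝ) := by
  have hpos := sqrt_one_sub_sq_pos hv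
  have hsq : ((√(1 / (2 * s)) : ℝ) : ℂ) ^ 2 = (1 / (2 * s) : ℝ) := by
    rw [← Complex.ofReal_pow, Real.sq_sqrt (by positivity)]
  unfold mainIntegrand
  rw [← Complex.exp_add]
  congr 1
  · rw [← hsq, ← mul_pow, sqrt_sq]
    rw [Complex.re_ofReal_mul, unitArc_re]
    positivity
  · rw [Complex.ofReal_exp]
    congr 1
    rw [← hsq, hsq, mul_inv]
    have hn' : (s : ℂ) ^ 2 = n := by exact_mod_cast hn
    have hs' : (s : ℂ) ≠ 0 := by exact_mod_cast hs.ne'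
    rw [← hn']
    have h := unitArc_sq_add_inv hv
    generalize (unitArc v ^ 2)⁻¹ = X at *
    generalize unitArc v ^ 2 = W at *
    push_cast
    field_simp
    linear_combination 4 * h

/-- Deformation of the segment of the major arc onto a circular arc. -/
theorem re_integral_mainIntegrand {n : ℕ} {s : ℝ} (hs : 0 < s) (hn : s ^ 2 = n) :
    (∫ y in -(√3 * (1 / (4 * s)))..√3 * (1 / (4 * s)),
        mainIntegrand n ((1 / (4 * s) : ℝ) + y * Complex.I)).re =
      2 * (√(1 / (2 * s)) * (1 / (2 * s))) *
        ∫ v in (-(1 / 2) : ℝ)..1 / 2, (1 - 4 * v ^ 2) * Real.exp (π * s * (1 - 2 * v ^ 2)) := by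
  set a := 1 / (4 * s) with ha
  set T := 1 / (2 * s) with hT
  have ha0 : 0 < a := by positivity
  have hT0 : 0 < T := by positivity
  have hTa : T = 2 * a := by rw [hT, ha]; field_simp; norm_num
  have hs3 : √3 ^ 2 = 3 := Real.sq_sqrt (by norm_num)
  have hball {t : ℂ} (h1 : a ≤ t.re) (h2 : ‖t‖ ≤ T) :
      t ∈ Metric.ball ((2 * T : ℝ) : ℂ) (2 * T) := by
    rw [Metric.mem_ball, Complex.dist_eq]
    apply lt_of_pow_lt_pow_left₀ 2 (by positivity)
    have h3 : ‖t‖ ^ 2 ≤ T ^ 2 := by gcongr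
    rw [Complex.sq_norm, Complex.normSq_apply] at *
    simp only [Complex.sub_re, Complex.sub_im, Complex.ofReal_re, Complex.ofReal_im]
    nlinarith
  have hre {t : ℂ} (h : t ∈ Metric.ball ((2 * T : ℝ) : ℂ) (2 * T)) : 0 < t.re := by
    rw [Metric.mem_ball, Complex.dist_eq] at h
    have := (abs_lt.1 ((Complex.abs_re_le_norm _).trans_lt h)).1
    simp only [Complex.sub_re, Complex.ofReal_re] at this
    linarith
  obtain ⟨P, hP⟩ := DifferentiableOn.isExactOn_ball (f := mainIntegrand n)
    (c := ((2 * T : ℝ) : ℂ)) (r := 2 * T)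
    fun t ht ↦ (differentiableAt_mainIntegrand n (hre ht)).differentiableWithinAt
  set c := √3 * a with hc
  have hc0 : 0 ≤ c := by positivity
  have hline (y : ℝ) (hy : y ∈ Set.uIcc (-c) c) :
      ((a : ℂ) + y * Complex.I) ∈ Metric.ball ((2 * T : ℝ) : ℂ) (2 * T) := by
    rw [Set.uIcc_of_le (by linarith)] at hy
    refine hball (by simp) ?_
    apply le_of_sq_le_sq _ hT0.le
    rw [Complex.sq_norm, Complex.normSq_add_mul_I]
    have : y ^ 2 ≤ c ^ 2 := sq_le_sq' hy.1 hy.2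
    rw [hTa]
    nlinarith
  have harc' (v : ℝ) (hv : |v| ≤ 1 / 2) :
      ((T : ℂ) * unitArc v ^ 2) ∈ Metric.ball ((2 * T : ℝ) : ℂ) (2 * T) := by
    have hpos := sqrt_one_sub_sq_pos hv
    have h : √(1 - v ^ 2) ^ 2 = 1 - v ^ 2 := Real.sq_sqrt (Real.sqrt_pos.1 hpos).le
    have hv2 : v ^ 2 ≤ 1 / 4 := by nlinarith [sq_abs v, abs_nonneg v]
    refine hball ?_ ?_
    · rw [Complex.re_ofReal_mul]
      have : (unitArc v ^ 2).re = 1 - 2 * v ^ 2 := by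
        unfold unitArc
        rw [sq, Complex.mul_re]
        simp
        linear_combination h
      rw [this, hTa]
      nlinarith
    · have : ‖unitArc v‖ ^ 2 = 1 := by
        rw [unitArc, Complex.sq_norm, Complex.normSq_add_mul_I, h]
        ring
      rw [norm_mul, norm_pow, this, mul_one, Complex.norm_real, Real.norm_of_nonneg hT0.le]
  have habs {v : ℝ} (hv : v ∈ Set.uIcc (-(1 / 2) : ℝ) (1 / 2)) : |v| ≤ 1 / 2 := by
    rw [Set.uIcc_of_le (by norm_num)] at hv
    exact abs_le.2 hv
  have I1 := intervalIntegral.integral_eq_sub_of_hasDerivAt (a := -c) (b := c)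
    (f := fun y : ℝ ↦ P ((a : ℂ) + y * Complex.I))
    (f' := fun y : ℝ ↦ mainIntegrand n ((a : ℂ) + y * Complex.I) * Complex.I)
    (fun y hy ↦ by
      have h1 : HasDerivAt (fun y : ℝ ↦ ((a : ℂ) + y * Complex.I)) (1 * Complex.I) y :=
        ((hasDerivAt_id y).ofReal_comp.mul_const _).const_add _
      have h2 := HasDerivAt.comp y (hP _ (hline y hy)) h1
      rwa [one_mul] at h2)
    (by
      refine ContinuousOn.intervalIntegrable fun y hy ↦ ContinuousAt.continuousWithinAt ?_
      refine ContinuousAt.mul ?_ continuousAt_const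
      exact ContinuousAt.comp (g := mainIntegrand n)
        (differentiableAt_mainIntegrand n (hre (hline y hy))).continuousAt (by fun_prop))
  have hd (v : ℝ) (hv : |v| ≤ 1 / 2) : HasDerivAt (fun v : ℝ ↦ (T : ℂ) * unitArc v ^ 2)
      (T * (2 * Complex.I * unitArc v ^ 2 / (√(1 - v ^ 2) : ℝ))) v :=
    (hasDerivAt_unitArc_sq hv).const_mul _
  set h : ℝ → ℂ := fun v ↦ 2 * (√T * T : ℝ) *
    ((Real.exp (π * s * (1 - 2 * v ^ 2)) : ℝ) * (unitArc v ^ 3 / (√(1 - v ^ 2) : ℝ))) with hh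
  have hcont : ContinuousOn h (Set.uIcc (-(1 / 2)) (1 / 2)) := by
    intro v hv
    refine ContinuousAt.continuousWithinAt ?_
    have hpos := sqrt_one_sub_sq_pos (habs hv)
    have : ((√(1 - v ^ 2) : ℝ) : ℂ) ≠ 0 := by exact_mod_cast hpos.ne'
    simp only [hh, unitArc]
    fun_prop (disch := assumption)
  have I2 := intervalIntegral.integral_eq_sub_of_hasDerivAt (a := -(1 / 2)) (b := 1 / 2)
    (f := fun v : ℝ ↦ P ((T : ℂ) * unitArc v ^ 2))
    (f' := fun v : ℝ ↦ h v * Complex.I)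
    (fun v hv ↦ by
      refine (HasDerivAt.comp v (hP _ (harc' v (habs hv))) (hd v (habs hv))).congr_deriv ?_
      rw [mainIntegrand_arc hs hn (habs hv)]
      simp only [hh]
      push_cast
      ring)
    (hcont.mul continuousOn_const).intervalIntegrable
  have hend (v : ℝ) (hv : |v| = 1 / 2) :
      (T : ℂ) * unitArc v ^ 2 = a + (2 * v * c : ℝ) * Complex.I := by
    have hv2 : v ^ 2 = 1 / 4 := by rw [← sq_abs, hv]; norm_num
    have e : √(1 - v ^ 2) = √3 / 2 := by
      rw [hv2, Real.sqrt_eq_iff_mul_self_eq (by norm_num) (by positivity)]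
      nlinarith
    have hv2' : (v : ℂ) ^ 2 = 1 / 4 := by rw [← Complex.ofReal_pow, hv2]; push_cast; rfl
    have hs3' : ((√3 : ℝ) : ℂ) ^ 2 = 3 := by rw [← Complex.ofReal_pow, hs3]; push_cast; rfl
    unfold unitArc
    rw [e, hTa, hc]
    push_cast
    linear_combination (a : ℂ) / 2 * hs3' + 2 * a * Complex.I ^ 2 * hv2' + a / 2 * Complex.I_sq
  have e1 : P ((T : ℂ) * unitArc (1 / 2) ^ 2) = P ((a : ℂ) + (c : ℝ) * Complex.I) := by
    rw [hend _ (by norm_num [abs_of_pos])]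
    norm_num
  have e2 : P ((T : ℂ) * unitArc (-(1 / 2)) ^ 2) = P ((a : ℂ) + ((-c : ℝ) : ℂ) * Complex.I) := by
    rw [hend _ (by norm_num [abs_of_pos])]
    norm_num
  rw [e1, e2, ← I1, intervalIntegral.integral_mul_const, intervalIntegral.integral_mul_const] at I2
  have I3 := mul_right_cancel₀ Complex.I_ne_zero I2
  rw [← I3]
  have I4 := Complex.reCLM.intervalIntegral_comp_comm
    (hcont.intervalIntegrable (μ := MeasureTheory.volume))
  simp only [Complex.reCLM_apply] at I4
  rw [← I4, ← intervalIntegral.integral_const_mul]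
  refine intervalIntegral.integral_congr fun v hv ↦ ?_
  simp only [hh]
  rw [show (2 : ℂ) * (√T * T : ℝ) = ((2 * (√T * T) : ℝ) : ℂ) by push_cast; rfl,
    Complex.re_ofReal_mul, Complex.re_ofReal_mul, re_unitArc_cube (habs hv)]
  ring
end Overpartition

namespace Overpartition

open Filter Topology MeasureTheory
open scoped Real

lemma abs_gaussian_sub_le {u : ℝ} (hu : 4 ≤ u) :
    |(∫ v in (-(1 / 2) : ℝ)..1 / 2, Real.exp (-(2 * u) * v ^ 2)) - √(π / (2 * u))| ≤
      Real.exp (-(u / 4)) := by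
  have h1 := integral_gaussian (2 * u)
  have h2 := integral_gaussian u
  have i1 := integrable_exp_neg_mul_sq (b := 2 * u) (by linarith)
  have i2 := integrable_exp_neg_mul_sq (b := u) (by linarith)
  rw [intervalIntegral.integral_of_le (by norm_num), ← h1,
    ← integral_indicator measurableSet_Ioc]
  have i3 : Integrable ((Set.Ioc (-(1 / 2) : ℝ) (1 / 2)).indicator
      fun v ↦ Real.exp (-(2 * u) * v ^ 2)) := i1.indicator measurableSet_Ioc
  have l1 : ∫ v, (Set.Ioc (-(1 / 2) : ℝ) (1 / 2)).indicator
      (fun v ↦ Real.exp (-(2 * u) * v ^ 2)) v ≤ ∫ v, Real.exp (-(2 * u) * v ^ 2) := by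
    refine integral_mono i3 i1 fun v ↦ ?_
    exact Set.indicator_le_self' (fun _ _ ↦ (Real.exp_pos _).le) v
  have l2 : ∫ v, Real.exp (-(2 * u) * v ^ 2) ≤ ∫ v, ((Set.Ioc (-(1 / 2) : ℝ) (1 / 2)).indicator
      (fun v ↦ Real.exp (-(2 * u) * v ^ 2)) v + Real.exp (-(u / 4)) * Real.exp (-u * v ^ 2)) := by
    refine integral_mono i1 (i3.add (i2.const_mul _)) fun v ↦ ?_
    by_cases hv : v ∈ Set.Ioc (-(1 / 2) : ℝ) (1 / 2)
    · simp only [Set.indicator_of_mem hv]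
      have := mul_pos (Real.exp_pos (-(u / 4))) (Real.exp_pos (-u * v ^ 2))
      linarith
    · simp only [Set.indicator_of_notMem hv, zero_add]
      rw [← Real.exp_add]
      apply Real.exp_le_exp.2
      have : 1 / 4 ≤ v ^ 2 := by
        by_contra! h
        exact hv ⟨by nlinarith, by nlinarith⟩
      nlinarith
  rw [integral_add i3 (i2.const_mul _), integral_const_mul, h2] at l2
  have hs : √(π / u) ≤ 1 := by
    rw [Real.sqrt_le_one, div_le_one (by linarith)]
    linarith [Real.pi_le_four]
  have := mul_le_of_le_one_right (Real.exp_pos (-(u / 4))).le hs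
  rw [abs_le]
  constructor <;> linarith [Real.exp_pos (-(u / 4))]

lemma integral_arc_eq {u : ℝ} (hu : 0 < u) :
    ∫ v in (-(1 / 2) : ℝ)..1 / 2, (1 - 4 * v ^ 2) * Real.exp (u * (1 - 2 * v ^ 2)) =
      Real.exp u * (1 / u * Real.exp (-(u / 2)) +
        (1 - 1 / u) * ∫ v in (-(1 / 2) : ℝ)..1 / 2, Real.exp (-(2 * u) * v ^ 2)) := by
  have hd (v : ℝ) : HasDerivAt (fun v ↦ v * Real.exp (-(2 * u) * v ^ 2))
      ((1 - 4 * u * v ^ 2) * Real.exp (-(2 * u) * v ^ 2)) v := by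
    have h1 : HasDerivAt (fun v : ℝ ↦ -(2 * u) * v ^ 2) (-(2 * u) * (2 * v)) v := by
      simpa using (hasDerivAt_pow 2 v).const_mul (-(2 * u))
    refine ((hasDerivAt_id v).mul h1.exp).congr_deriv ?_
    simp only [id]
    ring
  have h := intervalIntegral.integral_eq_sub_of_hasDerivAt (a := -(1 / 2)) (b := 1 / 2)
    (fun v _ ↦ hd v) (by apply Continuous.intervalIntegrable; fun_prop)
  have e (v : ℝ) : (1 - 4 * v ^ 2) * Real.exp (u * (1 - 2 * v ^ 2)) =
      Real.exp u * ((1 - 1 / u) * Real.exp (-(2 * u) * v ^ 2) +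
        1 / u * ((1 - 4 * u * v ^ 2) * Real.exp (-(2 * u) * v ^ 2))) := by
    rw [show u * (1 - 2 * v ^ 2) = u + -(2 * u) * v ^ 2 by ring, Real.exp_add]
    field_simp
    ring
  simp only [e]
  rw [intervalIntegral.integral_const_mul, intervalIntegral.integral_add
    (by apply Continuous.intervalIntegrable; fun_prop)
    (by apply Continuous.intervalIntegrable; fun_prop),
    intervalIntegral.integral_const_mul, intervalIntegral.integral_const_mul, h]
  rw [show -(2 * u) * (1 / 2) ^ 2 = -(u / 2) by ring,
    show -(2 * u) * (-(1 / 2)) ^ 2 = -(u / 2) by ring]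
  ring

/-- The leading term of the Hardy–Ramanujan–Rademacher expansion of the overpartition function. -/
noncomputable def mainTerm (x : ℝ) : ℝ := Real.exp (π * √x) / (8 * x) * (1 - 1 / (π * √x))

lemma abs_arc_sub_le {s : ℝ} (hs : 100 ≤ s) :
    |2 * (√(1 / (2 * s)) * (1 / (2 * s))) *
        (∫ v in (-(1 / 2) : ℝ)..1 / 2, (1 - 4 * v ^ 2) * Real.exp (π * s * (1 - 2 * v ^ 2))) -
      4 * (Real.exp (π * s) / (8 * s ^ 2) * (1 - 1 / (π * s)))| ≤
      Real.exp (π * s - π * s / 4) := by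
  have hp := Real.pi_gt_three
  set u := π * s with hu
  have hu0 : 300 ≤ u := by nlinarith
  rw [integral_arc_eq (by linarith)]
  have hK := abs_gaussian_sub_le (u := u) (by linarith)
  set K := ∫ v in (-(1 / 2) : ℝ)..1 / 2, Real.exp (-(2 * u) * v ^ 2)
  have e1 : √(π / (2 * u)) = √(1 / (2 * s)) := by
    congr 1
    rw [hu]
    field_simp
  rw [e1] at hK
  set r := √(1 / (2 * s)) with hr
  have hr2 : r ^ 2 = 1 / (2 * s) := Real.sq_sqrt (by positivity)
  have hr0 : 0 ≤ r := Real.sqrt_nonneg _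
  have h1s : 1 / (2 * s) ≤ 1 / 200 := one_div_le_one_div_of_le (by norm_num) (by linarith)
  have h1s0 : 0 < 1 / (2 * s) := by positivity
  have hr1 : r ≤ 1 := by nlinarith
  have e2 : Real.exp u / (8 * s ^ 2) = Real.exp u * ((1 / (2 * s)) ^ 2 / 2) := by
    field_simp
    norm_num
  rw [e2]
  have h1u : 1 / u ≤ 1 / 300 := one_div_le_one_div_of_le (by norm_num) (by linarith)
  have h1u0 : 0 < 1 / u := by positivity
  have e3 : 2 * (r * (1 / (2 * s))) * (Real.exp u * (1 / u * Real.exp (-(u / 2)) +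
      (1 - 1 / u) * K)) - 4 * (Real.exp u * ((1 / (2 * s)) ^ 2 / 2) * (1 - 1 / u)) =
      Real.exp u * ((2 * (r * (1 / (2 * s)))) *
        (1 / u * Real.exp (-(u / 2)) + (1 - 1 / u) * (K - r))) := by
    linear_combination (2 * (1 / (2 * s)) * Real.exp u * (1 - 1 / u)) * hr2
  rw [e3, sub_eq_add_neg u, Real.exp_add, abs_mul, abs_of_pos (Real.exp_pos u)]
  gcongr
  have hexp : Real.exp (-(u / 2)) ≤ Real.exp (-(u / 4)) := Real.exp_le_exp.2 (by linarith)
  have hE := Real.exp_pos (-(u / 4))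
  have hE2 := Real.exp_pos (-(u / 2))
  have b1 : |1 / u * Real.exp (-(u / 2)) + (1 - 1 / u) * (K - r)| ≤ 2 * Real.exp (-(u / 4)) := by
    refine (abs_add_le _ _).trans ?_
    rw [abs_mul, abs_mul, abs_of_pos h1u0, abs_of_pos hE2, abs_of_pos (by linarith : 0 < 1 - 1 / u)]
    nlinarith [abs_nonneg (K - r)]
  have b2 : 2 * (r * (1 / (2 * s))) ≤ 1 / 100 := by nlinarith
  rw [abs_mul, abs_of_nonneg (by positivity)]
  nlinarith [abs_nonneg (1 / u * Real.exp (-(u / 2)) + (1 - 1 / u) * (K - r))]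

theorem abs_overpartitionFn_sub_mainTerm_le {n : ℕ} (hn : 10000 ≤ n) :
    |overpartitionFn n - mainTerm n| ≤ Real.exp ((π - 2 / 5) * √n) := by
  set s := √(n : ℝ) with hs
  have hs2 : s ^ 2 = n := Real.sq_sqrt (by positivity)
  have hn' : (10000 : ℝ) ≤ n := by exact_mod_cast hn
  have hs100 : 100 ≤ s := Real.le_sqrt_of_sq_le (by linarith)
  set a := 1 / (4 * s) with ha
  have ha0 : 0 < a := by positivity
  have ha1 : a ≤ 1 / 400 := by
    rw [ha]
    exact one_div_le_one_div_of_le (by norm_num) (by linarith)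
  have hs3 : √3 ^ 2 = 3 := Real.sq_sqrt (by norm_num)
  have hs3' : √3 ≤ 2 := Real.sqrt_le_iff.2 ⟨by norm_num, by norm_num⟩
  have hcont (y : ℝ) : ContinuousAt (fun y : ℝ ↦ mainIntegrand n (a + y * Complex.I) / 2) y := by
    refine ContinuousAt.div_const ?_ _
    refine ContinuousAt.comp (g := mainIntegrand n)
      (differentiableAt_mainIntegrand n ?_).continuousAt (by fun_prop)
    simpa using ha0
  have hdiff := norm_integral_sub_le (continuous_cauchyIntegrand n ha0) (c := √3 * a)
    (g := fun y ↦ mainIntegrand n (a + y * Complex.I) / 2)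
    (B := Real.exp (π * n * a)) (C := Real.exp (π * s - 0.45 * s)) (by positivity) (by nlinarith)
    (ContinuousOn.intervalIntegrable fun y _ ↦ (hcont y).continuousWithinAt)
    (fun y hy ↦ norm_cauchyIntegrand_sub_le (by
      have : y ^ 2 ≤ (√3 * a) ^ 2 := by rw [← sq_abs]; gcongr
      nlinarith) ha0)
    (fun y h1 h2 ↦ norm_cauchyIntegrand_le hs100 hs2 h1 h2) (Real.exp_pos _).le (Real.exp_pos _).le
  have hre := (Complex.abs_re_le_norm _).trans hdiff
  rw [intervalIntegral.integral_div, Complex.sub_re] at hre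
  have hcf := congrArg Complex.re (overpartitionFn_eq_integral n ha0)
  rw [show (1 / 2 : ℂ) = ((1 / 2 : ℝ) : ℂ) by push_cast; rfl, Complex.re_ofReal_mul,
    Complex.natCast_re] at hcf
  rw [show (2 : ℂ) = ((2 : ℝ) : ℂ) by push_cast; rfl, Complex.div_ofReal_re,
    re_integral_mainIntegrand (by positivity) hs2] at hre
  have harc := abs_arc_sub_le hs100
  have hM : mainTerm n = Real.exp (π * s) / (8 * s ^ 2) * (1 - 1 / (π * s)) := by
    rw [mainTerm, hs2]
  rw [← hM] at harc
  have e1 : π * n * a = π * s / 4 := by rw [ha, ← hs2]; field_simp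
  rw [e1] at hre
  have hp := Real.pi_gt_three
  have k1 : Real.exp (π * s / 4) ≤ Real.exp (π * s - 0.45 * s) := Real.exp_le_exp.2 (by nlinarith)
  have k2 : Real.exp (π * s - π * s / 4) ≤ Real.exp (π * s - 0.45 * s) :=
    Real.exp_le_exp.2 (by nlinarith)
  have k3 : 6 * Real.exp (π * s - 0.45 * s) ≤ Real.exp ((π - 2 / 5) * s) := by
    rw [show (π - 2 / 5) * s = 0.05 * s + (π * s - 0.45 * s) by ring, Real.exp_add]
    gcongr
    linarith [Real.add_one_le_exp (0.05 * s)]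
  rw [abs_le] at *
  constructor <;> linarith
end Overpartition

namespace Overpartition

open Filter Topology MeasureTheory
open scoped Real

/-- The logarithm of the derivative of `mainTerm`, up to an additive constant, as a function of
`u = π √x`. -/
noncomputable def logDensity (u : ℝ) : ℝ := u - 5 * Real.log u + Real.log (u ^ 2 - 3 * u + 3)

/-- The derivative of `mainTerm`. -/
noncomputable def density (x : ℝ) : ℝ := π ^ 4 / 16 * Real.exp (logDensity (π * √x))

lemma quadratic_pos (u : ℝ) : 0 < u ^ 2 - 3 * u + 3 := by nlinarith [sq_nonneg (u - 3 / 2)]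

lemma density_pos (x : ℝ) : 0 < density x := by
  have := Real.pi_pos
  unfold density
  positivity

lemma exp_logDensity {u : ℝ} (hu : 0 < u) :
    Real.exp (logDensity u) = Real.exp u / u ^ 5 * (u ^ 2 - 3 * u + 3) := by
  unfold logDensity
  rw [Real.exp_add, Real.exp_sub, Real.exp_log (quadratic_pos u), mul_comm (5 : ℝ), Real.exp_mul,
    Real.exp_log hu]
  norm_cast

lemma hasDerivAt_pi_mul_sqrt {x : ℝ} (hx : 0 < x) :
    HasDerivAt (fun x ↦ π * √x) (π ^ 2 / (2 * (π * √x))) x := by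
  refine ((Real.hasDerivAt_sqrt hx.ne').const_mul π).congr_deriv ?_
  have := Real.pi_pos
  have := Real.sqrt_pos.2 hx
  field_simp

lemma mainTerm_eq {x : ℝ} (hx : 0 < x) :
    mainTerm x = π ^ 2 / 8 * (Real.exp (π * √x) * (1 / (π * √x) ^ 2 - 1 / (π * √x) ^ 3)) := by
  have := Real.pi_pos
  have h := Real.sqrt_pos.2 hx
  unfold mainTerm
  nth_rewrite 2 [← Real.sq_sqrt hx.le]
  field_simp

lemma hasDerivAt_mainTerm {x : ℝ} (hx : 0 < x) : HasDerivAt mainTerm (density x) x := by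
  have hp := Real.pi_pos
  have hs := Real.sqrt_pos.2 hx
  have hu : 0 < π * √x := by positivity
  have h1 : HasDerivAt (fun u : ℝ ↦ π ^ 2 / 8 * (Real.exp u * (1 / u ^ 2 - 1 / u ^ 3)))
      (π ^ 2 / 8 * (Real.exp (π * √x) * (1 / (π * √x) ^ 2 - 1 / (π * √x) ^ 3) +
        Real.exp (π * √x) * (-(2 / (π * √x) ^ 3) + 3 / (π * √x) ^ 4))) (π * √x) := by
    have a2 : HasDerivAt (fun u : ℝ ↦ 1 / u ^ 2) (-(2 / (π * √x) ^ 3)) (π * √x) := by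
      simp only [one_div]
      refine ((hasDerivAt_pow 2 (π * √x)).fun_inv (by positivity)).congr_deriv ?_
      field_simp
      norm_num
      ring
    have a3 : HasDerivAt (fun u : ℝ ↦ 1 / u ^ 3) (-(3 / (π * √x) ^ 4)) (π * √x) := by
      simp only [one_div]
      refine ((hasDerivAt_pow 3 (π * √x)).fun_inv (by positivity)).congr_deriv ?_
      field_simp
      norm_num
      ring
    refine (((Real.hasDerivAt_exp _).mul (a2.fun_sub a3)).const_mul _).congr_deriv ?_
    ring
  have h2 := HasDerivAt.comp x h1 (hasDerivAt_pi_mul_sqrt hx)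
  refine (h2.congr_of_eventuallyEq ?_).congr_deriv ?_
  · filter_upwards [lt_mem_nhds hx] with y hy
    exact mainTerm_eq hy
  · rw [density, exp_logDensity hu]
    generalize π * √x = u at *
    field_simp
    ring

lemma hasDerivAt_logDensity_sqrt {x : ℝ} (hx : 0 < x) :
    HasDerivAt (fun x ↦ logDensity (π * √x))
      (π ^ 2 / 2 * (1 / (π * √x) - 5 / (π * √x) ^ 2 +
        (2 * (π * √x) - 3) / ((π * √x) * ((π * √x) ^ 2 - 3 * (π * √x) + 3)))) x := by
  have hp := Real.pi_pos
  have hs := Real.sqrt_pos.2 hx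
  have hu : 0 < π * √x := by positivity
  have h1 : HasDerivAt logDensity (1 - 5 * (π * √x)⁻¹ +
      (2 * (π * √x) - 3) / ((π * √x) ^ 2 - 3 * (π * √x) + 3)) (π * √x) := by
    have q : HasDerivAt (fun u : ℝ ↦ u ^ 2 - 3 * u + 3) (2 * (π * √x) - 3) (π * √x) := by
      refine (((hasDerivAt_pow 2 _).sub ((hasDerivAt_id _).const_mul 3)).add_const 3).congr_deriv ?_
      norm_num
    exact ((hasDerivAt_id _).sub ((Real.hasDerivAt_log hu.ne').const_mul 5)).add
      (q.log (quadratic_pos _).ne')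
  refine (HasDerivAt.comp x h1 (hasDerivAt_pi_mul_sqrt hx)).congr_deriv ?_
  have := quadratic_pos (π * √x)
  generalize π * √x = u at *
  field_simp

lemma antitoneOn_deriv_logDensity_add {b : ℝ} :
    AntitoneOn (fun x ↦ π ^ 2 / 2 * (1 / (π * √x) - 5 / (π * √x) ^ 2 +
        (2 * (π * √x) - 3) / ((π * √x) * ((π * √x) ^ 2 - 3 * (π * √x) + 3))) + 1 / b ^ 2 * x)
      (Set.Icc 10000 b) := by
  have hp := Real.pi_gt_three
  have hd (x : ℝ) (hx : 10000 ≤ x) : HasDerivAt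
      (fun x ↦ π ^ 2 / 2 * (1 / (π * √x) - 5 / (π * √x) ^ 2 +
        (2 * (π * √x) - 3) / ((π * √x) * ((π * √x) ^ 2 - 3 * (π * √x) + 3))) + 1 / b ^ 2 * x)
      (π ^ 2 / 2 * ((-(1 / (π * √x) ^ 2) + 10 / (π * √x) ^ 3 +
        (-4 * (π * √x) ^ 3 + 15 * (π * √x) ^ 2 - 18 * (π * √x) + 9) /
          ((π * √x) * ((π * √x) ^ 2 - 3 * (π * √x) + 3)) ^ 2) * (π ^ 2 / (2 * (π * √x)))) +
        1 / b ^ 2) x := by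
    have hx0 : 0 < x := by linarith
    have hs := Real.sqrt_pos.2 hx0
    have hu : 0 < π * √x := by positivity
    have hq := quadratic_pos (π * √x)
    have h1 : HasDerivAt (fun u : ℝ ↦ 1 / u - 5 / u ^ 2 + (2 * u - 3) / (u * (u ^ 2 - 3 * u + 3)))
        (-(1 / (π * √x) ^ 2) + 10 / (π * √x) ^ 3 +
        (-4 * (π * √x) ^ 3 + 15 * (π * √x) ^ 2 - 18 * (π * √x) + 9) /
          ((π * √x) * ((π * √x) ^ 2 - 3 * (π * √x) + 3)) ^ 2) (π * √x) := by
      generalize π * √x = u at *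
      have a1 := (hasDerivAt_id u).fun_inv hu.ne'
      have a2 := ((hasDerivAt_pow 2 u).fun_inv (by positivity)).const_mul 5
      have q : HasDerivAt (fun u : ℝ ↦ u ^ 2 - 3 * u + 3) (2 * u - 3) u := by
        refine (((hasDerivAt_pow 2 _).sub
          ((hasDerivAt_id _).const_mul 3)).add_const 3).congr_deriv ?_
        norm_num
      have a3 := (((hasDerivAt_id u).const_mul 2).sub_const 3).fun_div ((hasDerivAt_id u).fun_mul q)
        (by simp only [id]; positivity)
      simp only [id] at a1 a2 a3
      have := (a1.fun_sub a2).fun_add a3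
      simp only [← one_div] at this
      simp only [mul_one_div] at this
      refine this.congr_deriv ?_
      field_simp
      ring
    refine (((HasDerivAt.comp x h1 (hasDerivAt_pi_mul_sqrt hx0)).const_mul _).add
      ((hasDerivAt_id x).const_mul (1 / b ^ 2))).congr_deriv ?_
    ring
  refine antitoneOn_of_deriv_nonpos (convex_Icc _ _)
    (fun x hx ↦ (hd x hx.1).continuousAt.continuousWithinAt)
    (fun x hx ↦ ?_) fun x hx ↦ ?_
  · rw [interior_Icc] at hx
    exact (hd x hx.1.le).differentiableAt.differentiableWithinAt
  · rw [interior_Icc] at hx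
    rw [(hd x hx.1.le).deriv]
    have hx1 := hx.1
    have hs : 100 ≤ √x := Real.le_sqrt_of_sq_le (by linarith)
    have hxs : √x ^ 2 = x := Real.sq_sqrt (by linarith)
    have hu : 300 ≤ π * √x := by nlinarith
    have hq := quadratic_pos (π * √x)
    have hb : 1 / b ^ 2 ≤ 1 / x ^ 2 := by
      gcongr
      exact hx.2.le
    have h2 : 1 / x ^ 2 = π ^ 4 / (π * √x) ^ 4 := by
      rw [show (π * √x) ^ 4 = π ^ 4 * (√x ^ 2) ^ 2 by ring, hxs]
      field_simp
    generalize π * √x = u at *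
    have h3 : (-4 * u ^ 3 + 15 * u ^ 2 - 18 * u + 9) / (u * (u ^ 2 - 3 * u + 3)) ^ 2 ≤ 0 := by
      apply div_nonpos_of_nonpos_of_nonneg _ (by positivity)
      nlinarith [mul_pos (by linarith : 0 < u) (by linarith : 0 < u),
        pow_pos (by linarith : 0 < u) 3]
    have h4 : -(1 / u ^ 2) + 10 / u ^ 3 ≤ -(4 / u ^ 3) := by
      have : 1 / u ^ 2 = u / u ^ 3 := by field_simp
      rw [this, ← neg_div, ← neg_div, ← add_div]
      gcongr
      linarith
    calc _ ≤ π ^ 2 / 2 * (-(4 / u ^ 3) * (π ^ 2 / (2 * u))) + 1 / x ^ 2 := by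
          gcongr
          linarith
      _ = 0 := by
          rw [h2]
          field_simp
          ring
end Overpartition

namespace Overpartition

open Filter Topology MeasureTheory
open scoped Real

lemma logDensity_add_le {a c b : ℝ} (ha : 10000 ≤ a) (hac : a ≤ c) (hc : c + 1 ≤ b) :
    logDensity (π * √(c + 1)) - logDensity (π * √c) ≤
      logDensity (π * √(a + 1)) - logDensity (π * √a) - 1 / b ^ 2 * (c - a) := by
  set d : ℝ → ℝ := fun x ↦ π ^ 2 / 2 * (1 / (π * √x) - 5 / (π * √x) ^ 2 +
    (2 * (π * √x) - 3) / ((π * √x) * ((π * √x) ^ 2 - 3 * (π * √x) + 3))) with hd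
  have hanti : AntitoneOn (fun x ↦ d x + 1 / b ^ 2 * x) (Set.Icc 10000 b) :=
    antitoneOn_deriv_logDensity_add
  have hD (x : ℝ) (hx : 10000 ≤ x) : HasDerivAt
      (fun x ↦ logDensity (π * √(x + 1)) - logDensity (π * √x) + 1 / b ^ 2 * x)
      (d (x + 1) - d x + 1 / b ^ 2) x := by
    have h1 := hasDerivAt_logDensity_sqrt (x := x) (by linarith)
    have h2 := (hasDerivAt_logDensity_sqrt (x := x + 1) (by linarith)).comp_add_const x 1
    refine ((h2.sub h1).add ((hasDerivAt_id x).const_mul (1 / b ^ 2))).congr_deriv ?_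
    rw [mul_one]
  have hA : AntitoneOn (fun x ↦ logDensity (π * √(x + 1)) - logDensity (π * √x) + 1 / b ^ 2 * x)
      (Set.Icc a c) := by
    refine antitoneOn_of_deriv_nonpos (convex_Icc _ _)
      (fun x hx ↦ (hD x (by linarith [hx.1])).continuousAt.continuousWithinAt)
      (fun x hx ↦ ?_) fun x hx ↦ ?_ <;> rw [interior_Icc] at hx
    · exact (hD x (by linarith [hx.1])).differentiableAt.differentiableWithinAt
    · rw [(hD x (by linarith [hx.1])).deriv]
      have := hanti (a := x) ⟨by linarith [hx.1], by linarith [hx.2]⟩ (b := x + 1)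
        ⟨by linarith [hx.1], by linarith [hx.2]⟩ (by linarith)
      simp only at this
      linarith
  have := hA (Set.left_mem_Icc.2 hac) (Set.right_mem_Icc.2 hac) hac
  simp only at this
  linarith

lemma exp_neg_le_one_sub_half {y : ℝ} (h0 : 0 ≤ y) (h1 : y ≤ 1) : Real.exp (-y) ≤ 1 - y / 2 := by
  rw [Real.exp_neg, inv_le_comm₀ (Real.exp_pos _) (by linarith)]
  refine le_trans ?_ (Real.add_one_le_exp y)
  rw [inv_le_iff_one_le_mul₀ (by linarith)]
  nlinarith

lemma density_mul_density_le {x p q : ℝ} (hx : 10001 ≤ x) (hp0 : 0 ≤ p) (hp1 : p ≤ 1)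
    (hq0 : 0 ≤ q) (hq1 : q ≤ 1) :
    density (x - 1 + p) * density (x + 1 + q) ≤
      density (x + p) * density (x + q) * (1 - 1 / (2 * (x + 2) ^ 2) * (1 + q - p)) := by
  have h := logDensity_add_le (a := x - 1 + p) (c := x + q) (b := x + 2) (by linarith)
    (by linarith) (by linarith)
  have e1 : x - 1 + p + 1 = x + p := by ring
  have e2 : x + q + 1 = x + 1 + q := by ring
  rw [e1, e2] at h
  set K := 1 / (x + 2) ^ 2 with hK
  have hK0 : 0 ≤ K := by positivity
  have hK1 : K ≤ 1 / 2 := by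
    rw [hK]
    exact one_div_le_one_div_of_le (by norm_num) (by nlinarith)
  have hK2 : 1 / (2 * (x + 2) ^ 2) = K / 2 := by rw [hK]; field_simp
  rw [hK2]
  have h3 := exp_neg_le_one_sub_half (y := K * (1 + q - p)) (by apply mul_nonneg <;> linarith)
    (by nlinarith)
  have e3 : (1 : ℝ) - K / 2 * (1 + q - p) = 1 - K * (1 + q - p) / 2 := by ring
  rw [e3]
  refine le_trans ?_ (mul_le_mul_of_nonneg_left h3
    (mul_pos (density_pos _) (density_pos _)).le)
  unfold density
  rw [mul_mul_mul_comm, mul_mul_mul_comm (π ^ 4 / 16) _ (π ^ 4 / 16), mul_assoc _ _ (Real.exp (-_)),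
    ← Real.exp_add, ← Real.exp_add, ← Real.exp_add]
  refine mul_le_mul_of_nonneg_left (Real.exp_le_exp.2 ?_) (by positivity)
  linarith

lemma continuousOn_density : ContinuousOn density (Set.Ioi 0) := by
  intro x hx
  refine ContinuousAt.continuousWithinAt ?_
  have := (hasDerivAt_logDensity_sqrt hx).continuousAt
  unfold density
  fun_prop

lemma continuousOn_density_add {x : ℝ} (hx : 0 < x) :
    ContinuousOn (fun p ↦ density (x + p)) (Set.uIcc 0 1) := by
  refine continuousOn_density.comp (by fun_prop) fun p hp ↦ ?_
  rw [Set.uIcc_of_le zero_le_one] at hp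
  exact Set.mem_Ioi.2 (by linarith [hp.1])

lemma integral_density {x : ℝ} (hx : 0 < x) :
    ∫ p in (0 : ℝ)..1, density (x + p) = mainTerm (x + 1) - mainTerm x := by
  have h := intervalIntegral.integral_eq_sub_of_hasDerivAt (a := 0) (b := 1)
    (f := fun p ↦ mainTerm (x + p)) (f' := fun p ↦ density (x + p))
    (fun p hp ↦ by
      rw [Set.uIcc_of_le zero_le_one] at hp
      exact (hasDerivAt_mainTerm (by linarith [hp.1])).comp_const_add x p)
    (continuousOn_density_add hx).intervalIntegrable
  rw [h, add_zero]

theorem mainTerm_turan {x : ℝ} (hx : 10001 ≤ x) :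
    (mainTerm x - mainTerm (x - 1)) * (mainTerm (x + 2) - mainTerm (x + 1)) ≤
      (1 - 1 / (2 * (x + 2) ^ 2)) * (mainTerm (x + 1) - mainTerm x) ^ 2 := by
  have i0 := integral_density (x := x - 1) (by linarith)
  have i1 := integral_density (x := x) (by linarith)
  have i2 := integral_density (x := x + 1) (by linarith)
  rw [sub_add_cancel] at i0
  rw [show x + 1 + 1 = x + 2 by ring] at i2
  have c0 := continuousOn_density_add (x := x - 1) (by linarith)
  have c1 := continuousOn_density_add (x := x) (by linarith)
  have c2 := continuousOn_density_add (x := x + 1) (by linarith)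
  set κ := 1 / (2 * (x + 2) ^ 2)
  set F := mainTerm (x + 1) - mainTerm x
  set m := ∫ p in (0 : ℝ)..1, p * density (x + p) with hm
  have c3 : ContinuousOn (fun p ↦ p * density (x + p)) (Set.uIcc 0 1) := continuousOn_id.mul c1
  have key (p : ℝ) (hp : p ∈ Set.Icc (0 : ℝ) 1) :
      density (x - 1 + p) * (mainTerm (x + 2) - mainTerm (x + 1)) ≤
        ((1 - κ) * F - κ * m) * density (x + p) + κ * F * (p * density (x + p)) := by
    have h := intervalIntegral.integral_mono_on (a := 0) (b := 1) (μ := volume) zero_le_one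
      (f := fun q ↦ density (x - 1 + p) * density (x + 1 + q))
      (g := fun q ↦ density (x + p) * (1 - κ * (1 - p)) * density (x + q) -
        density (x + p) * κ * (q * density (x + q)))
      (c2.const_mul _).intervalIntegrable
      ((c1.const_mul _).sub (c3.const_mul _)).intervalIntegrable
      (fun q hq ↦ by
        refine (density_mul_density_le hx hp.1 hp.2 hq.1 hq.2).trans (le_of_eq ?_)
        ring)
    rw [intervalIntegral.integral_const_mul, i2, intervalIntegral.integral_sub
      (c1.const_mul _).intervalIntegrable (c3.const_mul _).intervalIntegrable,
      intervalIntegral.integral_const_mul, intervalIntegral.integral_const_mul, i1, ← hm] at h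
    refine h.trans (le_of_eq ?_)
    ring
  have h := intervalIntegral.integral_mono_on (a := 0) (b := 1) (μ := volume) zero_le_one
    (c0.mul_const _).intervalIntegrable
    ((c1.const_mul _).fun_add (c3.const_mul _)).intervalIntegrable key
  rw [intervalIntegral.integral_mul_const, i0, intervalIntegral.integral_add
    (c1.const_mul _).intervalIntegrable (c3.const_mul _).intervalIntegrable,
    intervalIntegral.integral_const_mul, intervalIntegral.integral_const_mul, i1, ← hm] at h
  refine h.trans (le_of_eq ?_)
  ring

lemma mul_pow_seven_le_exp {s : ℝ} (hs : 100 ≤ s) : 1000 * s ^ 7 ≤ Real.exp (2 / 5 * s) := by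
  have h1 : (10 : ℝ) ^ 17 ≤ Real.exp 40 := by
    have h := pow_le_pow_left₀ (by norm_num) (Real.exp_one_gt_d9.le) 40
    rw [← Real.exp_nat_mul] at h
    norm_num at h ⊢
    linarith
  have h2 : (s / 100) ^ 7 ≤ Real.exp (2 / 5 * (s - 100)) := by
    have h := Real.add_one_le_exp (2 / 35 * (s - 100))
    have h' := pow_le_pow_left₀ (by positivity) 
      (by linarith : s / 100 ≤ Real.exp (2 / 35 * (s - 100))) 7
    rw [← Real.exp_nat_mul] at h'
    refine h'.trans (le_of_eq ?_)
    congr 1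
    push_cast
    ring
  calc 1000 * s ^ 7 = 10 ^ 17 * (s / 100) ^ 7 := by ring
    _ ≤ Real.exp 40 * Real.exp (2 / 5 * (s - 100)) := by gcongr
    _ = _ := by rw [← Real.exp_add]; congr 1; ring

lemma le_mainTerm_sub {x : ℝ} (hx : 10000 ≤ x) :
    3 * (Real.exp (π * √x) / (π * √(x + 1)) ^ 3) ≤ mainTerm (x + 1) - mainTerm x := by
  have hp := Real.pi_gt_three
  have hs : 100 ≤ √x := Real.le_sqrt_of_sq_le (by linarith)
  rw [← integral_density (by linarith)]
  have h := intervalIntegral.integral_mono_on (a := 0) (b := 1) (μ := volume) zero_le_one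
    (f := fun _ ↦ 3 * (Real.exp (π * √x) / (π * √(x + 1)) ^ 3))
    (g := fun p ↦ density (x + p)) intervalIntegrable_const
    (continuousOn_density_add (by linarith)).intervalIntegrable ?_
  · simpa using h
  · intro p hp'
    have h1 : √x ≤ √(x + p) := Real.sqrt_le_sqrt (by linarith [hp'.1])
    have h2 : √(x + p) ≤ √(x + 1) := Real.sqrt_le_sqrt (by linarith [hp'.2])
    have h3 : 300 ≤ π * √(x + p) := by nlinarith
    rw [density, exp_logDensity (by linarith)]
    have h4 : π * √x ≤ π * √(x + p) := by gcongr
    have h5 : π * √(x + p) ≤ π * √(x + 1) := by gcongr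
    generalize π * √(x + p) = u at *
    generalize π * √(x + 1) = w at *
    generalize π * √x = v at *
    have h6 : (81 : ℝ) ≤ π ^ 4 := by
      have := pow_le_pow_left₀ (by norm_num) hp.le 4
      norm_num at this
      linarith
    have h7 : 0.9 * u ^ 2 ≤ u ^ 2 - 3 * u + 3 := by nlinarith
    calc 3 * (Real.exp v / w ^ 3) ≤ 3 * (Real.exp u / u ^ 3) := by gcongr
      _ ≤ 81 / 16 * (Real.exp u / u ^ 5 * (0.9 * u ^ 2)) := by
        rw [show Real.exp u / u ^ 5 * (0.9 * u ^ 2) = 0.9 * (Real.exp u / u ^ 3) by field_simp]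
        have : 0 < Real.exp u / u ^ 3 := by positivity
        nlinarith
      _ ≤ _ := by gcongr

lemma abs_dPbar_sub_le {k : ℕ} (hk : 10000 ≤ k) :
    |dPbar k - (mainTerm (k + 1) - mainTerm k)| ≤
      1 / (12 * (k + 3) ^ 2) * (mainTerm (k + 1) - mainTerm k) := by
  have h0 := abs_overpartitionFn_sub_mainTerm_le hk
  have h1 := abs_overpartitionFn_sub_mainTerm_le (n := k + 1) (by omega)
  have hk' : (10000 : ℝ) ≤ k := by exact_mod_cast hk
  have hf := le_mainTerm_sub hk'
  push_cast at h1
  have hp := Real.pi_gt_three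
  have hp4 := Real.pi_lt_d2
  set s := √(k : ℝ) with hs
  set w := √((k : ℝ) + 1) with hw
  have hs2 : s ^ 2 = k := Real.sq_sqrt (by positivity)
  have hw2 : w ^ 2 = k + 1 := Real.sq_sqrt (by positivity)
  have hs100 : 100 ≤ s := Real.le_sqrt_of_sq_le (by linarith)
  have hw0 : 0 ≤ w := Real.sqrt_nonneg _
  have hsw : s ≤ w := Real.sqrt_le_sqrt (by linarith)
  have hws : w ≤ s + 1 / 200 := by nlinarith
  set E := Real.exp (π * s) with hE
  have hE0 : 0 < E := Real.exp_pos _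
  have b0 : Real.exp ((π - 2 / 5) * s) = E / Real.exp (2 / 5 * s) := by
    rw [hE, ← Real.exp_sub]; congr 1; ring
  have b1 : Real.exp ((π - 2 / 5) * w) ≤ 1.1 * (E / Real.exp (2 / 5 * s)) := by
    rw [← b0]
    have : (π - 2 / 5) * w ≤ 0.015 + (π - 2 / 5) * s := by nlinarith
    refine (Real.exp_le_exp.2 this).trans ?_
    rw [Real.exp_add]
    gcongr
    have := Real.abs_exp_sub_one_sub_id_le (x := 0.015) (by norm_num [abs_of_pos])
    rw [abs_le] at this
    norm_num at this ⊢
    linarith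
  rw [b0] at h0
  have h7 := mul_pow_seven_le_exp hs100
  have key : 2.1 * (E / Real.exp (2 / 5 * s)) ≤
      1 / (12 * ((k : ℝ) + 3) ^ 2) * (3 * (E / (π * w) ^ 3)) := by
    have hk3 : ((k : ℝ) + 3) ^ 2 ≤ 1.01 * s ^ 4 := by
      rw [← hs2]
      nlinarith
    have hw3 : w ^ 3 ≤ 1.01 * s ^ 3 := by
      have : w ≤ 1.0001 * s := by linarith
      calc w ^ 3 ≤ (1.0001 * s) ^ 3 := by gcongr
        _ = 1.0001 ^ 3 * s ^ 3 := by ring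
        _ ≤ _ := by gcongr; norm_num
    have hp3 : π ^ 3 ≤ 32 := by
      calc π ^ 3 ≤ 3.15 ^ 3 := by gcongr
        _ ≤ 32 := by norm_num
    have hden : 4 * ((k : ℝ) + 3) ^ 2 * (π * w) ^ 3 * 2.1 ≤ 1000 * s ^ 7 := by
      calc 4 * ((k : ℝ) + 3) ^ 2 * (π * w) ^ 3 * 2.1
          = 8.4 * (((k : ℝ) + 3) ^ 2 * (π ^ 3 * w ^ 3)) := by ring
        _ ≤ 8.4 * ((1.01 * s ^ 4) * (32 * (1.01 * s ^ 3))) := by gcongr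
        _ = 8.4 * 1.01 * 32 * 1.01 * s ^ 7 := by ring
        _ ≤ 1000 * s ^ 7 := by gcongr; norm_num
    have hw' : 0 < w := by linarith
    have : 1 / (12 * ((k : ℝ) + 3) ^ 2) * (3 * (E / (π * w) ^ 3)) =
        E / (4 * ((k : ℝ) + 3) ^ 2 * (π * w) ^ 3) := by
      field_simp
      norm_num
    rw [this, ← mul_div_assoc, div_le_div_iff₀ (Real.exp_pos _) (by positivity)]
    nlinarith
  have hk30 : 0 ≤ 1 / (12 * ((k : ℝ) + 3) ^ 2) := by positivity
  have hfin := key.trans (mul_le_mul_of_nonneg_left hf hk30)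
  unfold dPbar
  push_cast
  rw [abs_le] at *
  constructor <;> linarith

lemma mul_lt_sq_of_abs_sub_le {δ F₀ F₁ F₂ x y z : ℝ} (hδ0 : 0 < δ) (hδ1 : δ ≤ 1 / 12)
    (f₀ : 0 < F₀) (f₁ : 0 < F₁) (f₂ : 0 < F₂) (h : F₀ * F₂ ≤ (1 - 6 * δ) * F₁ ^ 2)
    (hx : |x - F₀| ≤ δ * F₀) (hy : |y - F₁| ≤ δ * F₁) (hz : |z - F₂| ≤ δ * F₂) :
    x * z < y ^ 2 := by
  rw [abs_le] at hx hy hz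
  have hz0 : 0 ≤ z := by nlinarith
  calc x * z ≤ ((1 + δ) * F₀) * ((1 + δ) * F₂) := by
        apply mul_le_mul _ _ hz0 (by positivity) <;> linarith
    _ = (1 + δ) ^ 2 * (F₀ * F₂) := by ring
    _ ≤ (1 + δ) ^ 2 * ((1 - 6 * δ) * F₁ ^ 2) := by gcongr
    _ = ((1 + δ) ^ 2 * (1 - 6 * δ)) * F₁ ^ 2 := by ring
    _ < (1 - δ) ^ 2 * F₁ ^ 2 := by
        gcongr
        nlinarith [pow_pos hδ0 2, pow_pos hδ0 3]
    _ = ((1 - δ) * F₁) ^ 2 := by ring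
    _ ≤ y ^ 2 := by
        refine pow_le_pow_left₀ ?_ ?_ 2 <;> nlinarith

theorem turan_dPbar_of_large {n : ℕ} (hn : 10001 ≤ n) :
    dPbar (n - 1) * dPbar (n + 1) < dPbar n ^ 2 := by
  obtain ⟨m, rfl⟩ : ∃ m, n = m + 1 := ⟨n - 1, by omega⟩
  rw [Nat.add_sub_cancel]
  have hm' : 10000 ≤ m := by omega
  clear hn
  have hm : (10000 : ℝ) ≤ m := by exact_mod_cast hm'
  have h0 := abs_dPbar_sub_le hm'
  have h1 := abs_dPbar_sub_le (k := m + 1) (by omega)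
  have h2 := abs_dPbar_sub_le (k := m + 1 + 1) (by omega)
  have ht := mainTerm_turan (x := m + 1) (by linarith)
  have pos (x : ℝ) (hx : 10000 ≤ x) : 0 < mainTerm (x + 1) - mainTerm x := by
    have := Real.pi_pos
    have := Real.sqrt_pos.2 (by linarith : 0 < x + 1)
    exact lt_of_lt_of_le (by positivity) (le_mainTerm_sub hx)
  have f0 := pos m hm
  have f1 := pos (m + 1) (by linarith)
  have f2 := pos (m + 1 + 1) (by linarith)
  push_cast at h1 h2
  rw [add_sub_cancel_right, show (m : ℝ) + 1 + 2 = m + 1 + 1 + 1 by ring] at ht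
  have e : 1 / (2 * ((m : ℝ) + 1 + 1 + 1) ^ 2) = 6 * (1 / (12 * ((m : ℝ) + 3) ^ 2)) := by
    field_simp
    ring
  rw [e] at ht
  have hden : 1 ≤ ((m : ℝ) + 3) ^ 2 := one_le_pow₀ (by linarith)
  have goal : (dPbar m : ℝ) * dPbar (m + 1 + 1) < (dPbar (m + 1) : ℝ) ^ 2 := by
    refine mul_lt_sq_of_abs_sub_le (δ := 1 / (12 * ((m : ℝ) + 3) ^ 2)) (by positivity)
      (one_div_le_one_div_of_le (by norm_num) (by linarith)) f0 f1 f2 ht h0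
      (h1.trans (mul_le_mul_of_nonneg_right ?_ f1.le))
      (h2.trans (mul_le_mul_of_nonneg_right ?_ f2.le)) <;>
    · gcongr
      linarith
  exact_mod_cast goal

end Overpartition

namespace Overpartition

open PowerSeries

/-! ### Arithmetic with packed sequences -/

/-- Application of a function to a number which the kernel evaluates first. -/
def force {α : Type} (n : ℕ) (f : ℕ → α) : α :=
  Nat.rec (f 0) (fun m _ ↦ f (m + 1)) n

lemma force_eq {α : Type} (n : ℕ) (f : ℕ → α) : force n f = f n := by
  cases n <;> rfl

/-- The terms of positive sign among the first `2 * k` terms of the pentagonal series at `B`. -/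
def pentPos (B : ℕ) : ℕ → ℕ
  | 0 => 0
  | k + 1 => pentPos B k +
      B ^ (if k % 2 = 0 then k * (3 * k + 1) / 2 else (k + 1) * (3 * k + 2) / 2)

/-- The terms of negative sign among the first `2 * k` terms of the pentagonal series at `B`. -/
def pentNeg (B : ℕ) : ℕ → ℕ
  | 0 => 0
  | k + 1 => pentNeg B k +
      B ^ (if k % 2 = 0 then (k + 1) * (3 * k + 2) / 2 else k * (3 * k + 1) / 2)

/-- Newton's iteration for the inverse of `F` modulo `B ^ e`. -/
def newtonInv (B F : ℕ) : ℕ → ℕ → ℕ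
  | 0, _ => 1
  | k + 1, e => force (B ^ e) fun M ↦ force (newtonInv B F k ((e + 1) / 2)) fun x ↦
      x * (2 + M - F % M * x % M) % M

/-- The Turán inequality for the differences of the digits number `i, …, i + 3` of `x` in
base `B`. -/
def DigitTuran (B x i : ℕ) : Prop :=
  (x / B ^ (i + 1) % B) * (x / B ^ (i + 2) % B) + (x / B ^ (i + 1) % B) * (x / B ^ (i + 3) % B) +
    (x / B ^ i % B) * (x / B ^ (i + 2) % B) <
  (x / B ^ (i + 2) % B) * (x / B ^ (i + 2) % B) + (x / B ^ (i + 1) % B) * (x / B ^ (i + 1) % B) +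
    (x / B ^ i % B) * (x / B ^ (i + 3) % B)

/-- Test of `DigitTuran B x i` for all `i < l`. -/
def turanBelow (B : ℕ) : ℕ → ℕ → Bool
  | 0, _ => true
  | l + 1, x =>
    force (x % B) fun a ↦ force (x / B % B) fun b ↦ force (x / B ^ 2 % B) fun c ↦
    force (x / B ^ 3 % B) fun d ↦
      Nat.blt (b * c + b * d + a * c) (c * c + b * b + a * d) && force (x / B) (turanBelow B l)

/-- Test of `DigitTuran B x i` for all `i < l * 2 ^ k`. -/
def turanSplit (B l : ℕ) : ℕ → ℕ → Bool
  | 0, x => turanBelow B l x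
  | k + 1, x => force (x % B ^ (l * 2 ^ k + 3)) (turanSplit B l k) &&
      force (x / B ^ (l * 2 ^ k)) (turanSplit B l k)

/-- Test of the Turán inequality for the differences of the overpartition function: with
`B = 2 ^ b`, the number `V` is the generating function at `B` modulo `B ^ N`. -/
def turanTest (b N : ℕ) : Bool :=
  force (2 ^ b) fun B ↦ force (B ^ N) fun M ↦
  force ((pentPos B 83 + (M - 1) * pentNeg B 83) % M) fun F ↦
  force ((pentPos (B ^ 2) 83 + (M - 1) * pentNeg (B ^ 2) 83) % M) fun R ↦
  force (newtonInv B F 14 N) fun W ↦ Nat.beq (W * F % M) 1 &&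
  force (R * W % M * W % M) fun V ↦ turanSplit B 20 9 (V / B ^ 7)

theorem turanTest_eq_true : turanTest 464 10250 = true := by decide +kernel

/-! ### Correctness of the digit tests -/

lemma DigitTuran.of_div {B x i j : ℕ} (h : DigitTuran B (x / B ^ j) i) :
    DigitTuran B x (j + i) := by
  simpa only [DigitTuran, Nat.div_div_eq_div_mul, ← pow_add, ← add_assoc] using h

lemma mod_pow_div_pow_mod {B x i m : ℕ} (h : i < m) :
    x % B ^ m / B ^ i % B = x / B ^ i % B := by
  obtain ⟨k, rfl⟩ : ∃ k, m = i + (k + 1) := ⟨m - i - 1, by omega⟩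
  rw [pow_add, Nat.mod_mul_right_div_self, Nat.mod_mod_of_dvd _ (dvd_pow_self B k.succ_ne_zero)]

lemma DigitTuran.of_mod {B x i m : ℕ} (hi : i + 3 < m) (h : DigitTuran B (x % B ^ m) i) :
    DigitTuran B x i := by
  unfold DigitTuran at h
  rwa [mod_pow_div_pow_mod (by omega), mod_pow_div_pow_mod (by omega),
    mod_pow_div_pow_mod (by omega), mod_pow_div_pow_mod (by omega)] at h

lemma digitTuran_of_turanBelow {B l x : ℕ} (h : turanBelow B l x = true) {i : ℕ} (hi : i < l) :
    DigitTuran B x i := by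
  induction l generalizing x i with
  | zero => omega
  | succ l ih =>
    simp only [turanBelow, force_eq, Bool.and_eq_true] at h
    rcases i with _ | i
    · have := h.1
      simp only [Nat.blt, Nat.ble_eq] at this
      simpa [DigitTuran] using this
    · rw [add_comm]
      exact DigitTuran.of_div (by simpa using ih h.2 (by omega))

lemma digitTuran_of_turanSplit {B l k x : ℕ} (h : turanSplit B l k x = true) {i : ℕ}
    (hi : i < l * 2 ^ k) : DigitTuran B x i := by
  induction k generalizing x i with
  | zero => exact digitTuran_of_turanBelow h (by simpa using hi)
  | succ k ih =>
    simp only [turanSplit, force_eq, Bool.and_eq_true] at h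
    rw [pow_succ] at hi
    rcases lt_or_ge i (l * 2 ^ k) with h' | h'
    · exact DigitTuran.of_mod (by omega) (ih h.1 h')
    · obtain ⟨j, rfl⟩ := Nat.exists_eq_add_of_le h'
      exact DigitTuran.of_div (ih h.2 (by linarith))

lemma sum_mul_pow_lt {B N : ℕ} {p : ℕ → ℕ} (hp : ∀ i < N, p i < B) :
    ∑ i ∈ Finset.range N, p i * B ^ i < B ^ N := by
  induction N with
  | zero => simp
  | succ N ih =>
    rw [Finset.sum_range_succ, pow_succ]
    have h1 := ih fun i hi ↦ hp i (by omega)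
    have h2 : (p N + 1) * B ^ N ≤ B * B ^ N := Nat.mul_le_mul_right _ (hp N (by omega))
    linarith

lemma sum_mul_pow_div_pow_mod {B N : ℕ} {p : ℕ → ℕ} (hp : ∀ i < N, p i < B) {j : ℕ}
    (hj : j < N) : (∑ i ∈ Finset.range N, p i * B ^ i) / B ^ j % B = p j := by
  induction j generalizing N p with
  | zero =>
    obtain ⟨N, rfl⟩ : ∃ n, N = n + 1 := ⟨N - 1, by omega⟩
    have : ∑ i ∈ Finset.range N, p (i + 1) * B ^ (i + 1) =
        B * ∑ i ∈ Finset.range N, p (i + 1) * B ^ i := by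
      rw [Finset.mul_sum]
      exact Finset.sum_congr rfl fun i _ ↦ by ring
    rw [Finset.sum_range_succ', this]
    simpa using Nat.mod_eq_of_lt (hp 0 (by omega))
  | succ j ih =>
    obtain ⟨N, rfl⟩ : ∃ n, N = n + 1 := ⟨N - 1, by omega⟩
    have h0 := hp 0 (by omega)
    have : ∑ i ∈ Finset.range N, p (i + 1) * B ^ (i + 1) =
        B * ∑ i ∈ Finset.range N, p (i + 1) * B ^ i := by
      rw [Finset.mul_sum]
      exact Finset.sum_congr rfl fun i _ ↦ by ring
    rw [Finset.sum_range_succ', this, pow_succ', ← Nat.div_div_eq_div_mul, pow_zero, mul_one,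
      Nat.mul_add_div (by omega), Nat.div_eq_of_lt h0, add_zero]
    exact ih (p := fun i ↦ p (i + 1)) (fun i hi ↦ hp _ (by omega)) (by omega)

/-! ### Truncation of the pentagonal series -/

/-- The first `2 * K` terms of the pentagonal series. -/
noncomputable def pentPoly (K : ℕ) : Polynomial ℤ :=
  ∑ k ∈ Finset.range K, (-1) ^ k *
    (Polynomial.X ^ (k * (3 * k + 1) / 2) - Polynomial.X ^ ((k + 1) * (3 * k + 2) / 2))

lemma eval_pentPoly (B K : ℕ) : (pentPoly K).eval (B : ℤ) = pentPos B K - pentNeg B K := by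
  induction K with
  | zero => simp [pentPoly, pentPos, pentNeg]
  | succ k ih =>
    rw [pentPoly, Finset.sum_range_succ, ← pentPoly, Polynomial.eval_add, ih, pentPos, pentNeg]
    simp only [Polynomial.eval_mul, Polynomial.eval_pow, Polynomial.eval_neg, Polynomial.eval_one,
      Polynomial.eval_sub, Polynomial.eval_X]
    split_ifs with h
    · rw [(Nat.even_iff.2 h).neg_one_pow]
      push_cast
      ring
    · rw [(Nat.not_even_iff_odd.1 (by rwa [Nat.even_iff])).neg_one_pow]
      push_cast
      ring

lemma pentagonal_neg_natCast (k : ℕ) : pentagonal (-k) = k * (3 * k + 1) / 2 := by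
  rw [pentagonal_neg]
  have : ((k : ℤ) * (3 * k + 1) / 2) = ((k * (3 * k + 1) / 2 : ℕ) : ℤ) := by push_cast; rfl
  rw [this, Int.toNat_natCast]

lemma pentagonal_natCast_add_one (k : ℕ) :
    pentagonal (k + 1) = (k + 1) * (3 * k + 2) / 2 := by
  rw [pentagonal_def]
  have : (((k : ℤ) + 1) * (3 * (k + 1) - 1) / 2) = (((k + 1) * (3 * k + 2) / 2 : ℕ) : ℤ) := by
    push_cast
    congr 2
    ring
  rw [this, Int.toNat_natCast]

lemma coe_pentPoly (K : ℕ) : (pentPoly K : ℤ⟦X⟧) = ∑ k ∈ Finset.range K,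
    (-1) ^ k * ((X : ℤ⟦X⟧) ^ pentagonal (-k) - X ^ pentagonal (k + 1)) := by
  rw [pentPoly, ← Polynomial.coeToPowerSeries.ringHom_apply, map_sum]
  refine Finset.sum_congr rfl fun k _ ↦ ?_
  rw [pentagonal_neg_natCast, pentagonal_natCast_add_one]
  simp

lemma X_pow_dvd_pentPoly_sub {N K L : ℕ} (h : 2 * N ≤ K * (3 * K + 1)) (hL : K ≤ L) :
    (X : ℤ⟦X⟧) ^ N ∣ pentPoly L - pentPoly K := by
  rw [coe_pentPoly, coe_pentPoly, ← Finset.sum_range_add_sum_Ico _ hL, add_sub_cancel_left]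
  refine Finset.dvd_sum fun k hk ↦ Dvd.dvd.mul_left ?_ _
  have hk := (Finset.mem_Ico.1 hk).1
  have h1 : K * (3 * K + 1) ≤ k * (3 * k + 1) := by gcongr
  have h2 : k * (3 * k + 1) ≤ (k + 1) * (3 * k + 2) := by gcongr <;> omega
  rw [pentagonal_neg_natCast, pentagonal_natCast_add_one]
  exact dvd_sub (pow_dvd_pow _ (by omega)) (pow_dvd_pow _ (by omega))

open WithPiTopology Filter in
lemma X_pow_dvd_pentagonalSeries_sub {N K : ℕ} (h : 2 * N ≤ K * (3 * K + 1)) :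
    (X : ℤ⟦X⟧) ^ N ∣ pentagonalSeries ℤ - pentPoly K := by
  let : TopologicalSpace ℤ := ⊥
  have : DiscreteTopology ℤ := ⟨rfl⟩
  have h2 := (hasSum_pow_pentagonal_sub_pentagonalSeries ℤ).tendsto_sum_nat
  rw [tendsto_iff_coeff_tendsto] at h2
  rw [X_pow_dvd_iff]
  intro n hn
  have h3 := h2 n
  rw [nhds_discrete, tendsto_pure] at h3
  obtain ⟨L, h3, hL⟩ := (h3.and (eventually_ge_atTop K)).exists
  rw [map_sub, ← h3, ← coe_pentPoly, ← map_sub]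
  exact X_pow_dvd_iff.1 (X_pow_dvd_pentPoly_sub h hL) n hn

lemma pow_dvd_eval_of_X_pow_dvd {P : Polynomial ℤ} {N : ℕ} (h : (X : ℤ⟦X⟧) ^ N ∣ P) (b : ℤ) :
    b ^ N ∣ P.eval b := by
  have h1 : Polynomial.X ^ N ∣ P := by
    rw [Polynomial.X_pow_dvd_iff]
    intro d hd
    simpa using X_pow_dvd_iff.1 h d hd
  simpa using Polynomial.eval_dvd (x := b) h1

/-- The functional equation of the generating function modulo `B ^ N`. -/
theorem sum_overpartitionFn_modEq {B N K : ℕ} (h : 2 * N ≤ K * (3 * K + 1)) :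
    (∑ i ∈ Finset.range N, (overpartitionFn i : ℤ) * B ^ i) *
      ((pentPos B K - pentNeg B K) ^ 2) ≡ pentPos (B ^ 2) K - pentNeg (B ^ 2) K
        [ZMOD B ^ N] := by
  set P : Polynomial ℤ :=
    ∑ i ∈ Finset.range N, Polynomial.monomial i (overpartitionFn i : ℤ) with hP
  have hP1 : (X : ℤ⟦X⟧) ^ N ∣ overSeries - P := by
    rw [X_pow_dvd_iff]
    intro m hm
    rw [hP, map_sub, Polynomial.coeff_coe, Polynomial.finsetSum_coeff]
    simp [Polynomial.coeff_monomial, overSeries, hm]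
  have hP2 : P.eval (B : ℤ) = ∑ i ∈ Finset.range N, (overpartitionFn i : ℤ) * B ^ i := by
    simp [hP, Polynomial.eval_finsetSum]
  have hQ := X_pow_dvd_pentagonalSeries_sub h
  have hR : (X : ℤ⟦X⟧) ^ N ∣ expand 2 two_ne_zero (pentagonalSeries ℤ) -
      ((pentPoly K).comp (Polynomial.X ^ 2) : Polynomial ℤ) := by
    have h1 := map_dvd (expand (R := ℤ) 2 two_ne_zero) hQ
    rw [map_pow, expand_X, ← pow_mul, map_sub] at h1
    refine (pow_dvd_pow _ (by omega)).trans (h1.trans (dvd_of_eq ?_))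
    congr 1
    rw [← Polynomial.expand_eq_comp_X_pow]
    ext n
    rw [Polynomial.coeff_coe, PowerSeries.coeff_expand, Polynomial.coeff_expand two_pos,
      Polynomial.coeff_coe]
  have key : (X : ℤ⟦X⟧) ^ N ∣
      (P * pentPoly K ^ 2 - (pentPoly K).comp (Polynomial.X ^ 2) : Polynomial ℤ) := by
    push_cast
    have h1 : (X : ℤ⟦X⟧) ^ N ∣
        overSeries * pentagonalSeries ℤ ^ 2 - P * (pentPoly K : ℤ⟦X⟧) ^ 2 := by
      have : overSeries * pentagonalSeries ℤ ^ 2 - P * (pentPoly K : ℤ⟦X⟧) ^ 2 =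
          (overSeries - P) * pentagonalSeries ℤ ^ 2 + P * (pentagonalSeries ℤ + pentPoly K) *
            (pentagonalSeries ℤ - pentPoly K) := by ring
      rw [this]
      exact dvd_add (hP1.mul_right _) (hQ.mul_left _)
    rw [overSeries_mul_sq] at h1
    simpa using dvd_sub hR h1
  have := pow_dvd_eval_of_X_pow_dvd key B
  simp only [Polynomial.eval_sub, Polynomial.eval_mul, Polynomial.eval_pow, Polynomial.eval_comp,
    Polynomial.eval_X, hP2, eval_pentPoly] at this
  have h4 := eval_pentPoly (B ^ 2) K
  push_cast at h4
  rw [h4] at this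
  exact ((Int.modEq_iff_dvd).2 this).symm

lemma overpartitionFn_lt {n : ℕ} (hn : n < 10250) : overpartitionFn n < 2 ^ 464 := by
  have ht : (0 : ℝ) < 1 / 200 := by norm_num
  have hq := exp_neg_pi_mul_lt_one ht
  set r := Real.exp (-(Real.pi * (1 / 200))) with hr
  have hr0 : 0 < r := Real.exp_pos _
  have h1 := hasSum_overpartitionFn (q := (r : ℂ)) (by simpa [abs_of_pos hr0] using hq)
  have h2 := norm_overGen_le ht (by norm_num)
  have h3 : HasSum (fun m ↦ (overpartitionFn m : ℝ) * r ^ m) (overGen r).re := by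
    have := Complex.hasSum_re h1
    convert this using 2 with m
    norm_cast
  have h4 : (overpartitionFn n : ℝ) * r ^ n ≤ Real.exp (Real.pi / (4 * (1 / 200))) :=
    (le_hasSum h3 n fun m _ ↦ by positivity).trans ((Complex.re_le_norm _).trans h2)
  have h5 : (overpartitionFn n : ℝ) ≤ Real.exp (Real.pi * (405 / 4)) := by
    have h6 : r ^ n = Real.exp (-(Real.pi * (n / 200))) := by
      rw [hr, ← Real.exp_nat_mul]
      congr 1
      ring
    rw [h6, Real.exp_neg, ← div_eq_mul_inv, div_le_iff₀ (Real.exp_pos _), ← Real.exp_add] at h4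
    refine h4.trans (Real.exp_le_exp.2 ?_)
    have : (n : ℝ) < 10250 := by exact_mod_cast hn
    calc Real.pi / (4 * (1 / 200)) + Real.pi * (n / 200) = Real.pi * (50 + n / 200) := by ring
      _ ≤ Real.pi * (405 / 4) := by
        gcongr
        linarith
  have h7 : Real.exp (Real.pi * (405 / 4)) < 2 ^ 464 := by
    rw [← Real.exp_log (show (0 : ℝ) < 2 by norm_num), ← Real.exp_nat_mul, Real.exp_lt_exp]
    have := Real.log_two_gt_d9
    have := Real.pi_lt_d2
    push_cast
    linarith
  exact_mod_cast h5.trans_lt h7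

/-- `turanTest` is correct. -/
theorem digitTuran_of_turanTest {b N : ℕ} (h : turanTest b N = true) (hb : 0 < b)
    (hN : 2 * N ≤ 83 * (3 * 83 + 1)) (hN' : 10250 ≤ N) (hp : ∀ i < N, overpartitionFn i < 2 ^ b)
    {n : ℕ} (hn : 7 ≤ n) (hn' : n < 10247) :
    (overpartitionFn (n + 1)) * (overpartitionFn (n + 2)) +
      (overpartitionFn (n + 1)) * (overpartitionFn (n + 3)) +
      (overpartitionFn n) * (overpartitionFn (n + 2)) <
    (overpartitionFn (n + 2)) * (overpartitionFn (n + 2)) +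
      (overpartitionFn (n + 1)) * (overpartitionFn (n + 1)) +
      (overpartitionFn n) * (overpartitionFn (n + 3)) := by
  simp only [turanTest, force_eq, Bool.and_eq_true, Nat.beq_eq] at h
  have hB : 1 < 2 ^ b := Nat.one_lt_two_pow hb.ne'
  generalize 2 ^ b = B at *
  have hM : 1 ≤ B ^ N := Nat.one_le_pow _ _ (by omega)
  have hF (x y : ℕ) : (((x + (B ^ N - 1) * y) % B ^ N : ℕ) : ℤ) ≡ x - y [ZMOD B ^ N] := by
    push_cast [Nat.cast_sub hM]
    refine (Int.mod_modEq _ _).trans ?_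
    rw [Int.modEq_iff_dvd]
    exact ⟨-y, by ring⟩
  have key := sum_overpartitionFn_modEq (B := B) hN
  have hF1 := hF (pentPos B 83) (pentNeg B 83)
  have hR1 := hF (pentPos (B ^ 2) 83) (pentNeg (B ^ 2) 83)
  generalize (pentPos B 83 + (B ^ N - 1) * pentNeg B 83) % B ^ N = F at *
  generalize (pentPos (B ^ 2) 83 + (B ^ N - 1) * pentNeg (B ^ 2) 83) % B ^ N = R at *
  generalize newtonInv B F 14 N = W at *
  obtain ⟨hW, h⟩ := h
  have hlt := sum_mul_pow_lt hp
  have hV : R * W % B ^ N * W % B ^ N = ∑ i ∈ Finset.range N, overpartitionFn i * B ^ i := by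
    have hW' : (W * F : ℤ) ≡ 1 [ZMOD B ^ N] := by
      have := Int.mod_modEq (W * F : ℤ) (B ^ N)
      rw [show (W * F : ℤ) % B ^ N = 1 by exact_mod_cast hW] at this
      exact this.symm
    have : R * W % B ^ N * W ≡ ∑ i ∈ Finset.range N, overpartitionFn i * B ^ i [MOD B ^ N] := by
      refine ((Nat.mod_modEq _ _).mul_right _).trans ?_
      rw [← Int.natCast_modEq_iff]
      push_cast
      set V := ∑ i ∈ Finset.range N, (overpartitionFn i : ℤ) * B ^ i
      calc (R * W * W : ℤ) ≡ (V * F ^ 2) * W * W [ZMOD B ^ N] := by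
            refine Int.ModEq.mul_right _ (Int.ModEq.mul_right _ ?_)
            exact hR1.trans (key.symm.trans ((hF1.symm.pow 2).mul_left _))
        _ = V * (W * F) ^ 2 := by ring
        _ ≡ V * 1 ^ 2 [ZMOD B ^ N] := (hW'.pow 2).mul_left _
        _ = V := by ring
    rw [this, Nat.mod_eq_of_lt hlt]
  rw [hV] at h
  have := DigitTuran.of_div (digitTuran_of_turanSplit h (i := n - 7) (by omega))
  rw [Nat.add_sub_cancel' hn, DigitTuran, sum_mul_pow_div_pow_mod hp (by omega),
    sum_mul_pow_div_pow_mod hp (by omega), sum_mul_pow_div_pow_mod hp (by omega),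
    sum_mul_pow_div_pow_mod hp (by omega)] at this
  exact this

theorem turan_dPbar_of_small {n : ℕ} (hn : 8 ≤ n) (hn' : n ≤ 10000) :
    dPbar (n - 1) * dPbar (n + 1) < dPbar n ^ 2 := by
  obtain ⟨m, rfl⟩ : ∃ m, n = m + 1 := ⟨n - 1, by omega⟩
  have h := digitTuran_of_turanTest turanTest_eq_true (by norm_num) (by norm_num) le_rfl
    (fun i hi ↦ overpartitionFn_lt hi) (n := m) (by omega) (by omega)
  zify at h
  simp only [Nat.add_sub_cancel, dPbar]
  linarith

end Overpartition

theorem turan_dPbar (n : ℕ) (hn : 8 ≤ n) :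
    (dPbar n) ^ 2 > dPbar (n - 1) * dPbar (n + 1) := by
  rcases le_or_gt n 10000 with h | h
  · exact Overpartition.turan_dPbar_of_small hn h
  · exact Overpartition.turan_dPbar_of_large h
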